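/- Let (A, m, k) be a Noetherian complete local domain with k algebraically closed of characteristic p, and let F: 0 → F_n → ⋯ → F_0 → 0 be a complex of finite rank free A-modules with nonzero finite length homology. If n < dim A, then choosing x = p (mixed characteristic) or any 0 ≠ x ∈ m (equal characteristic) and B = A/(x), the Dutta multiplicity of F ⊗_A B is strictly positive. Combined with its vanishing, this yields the New Intersection Theorem: n ≥ dim A. -/

import Mathlib

open CategoryTheory
set_option linter.all false

section
open CategoryTheory

structure FM (R : Type) where
  ι : Type
  [fin : Fintype ι]
  [dec : DecidableEq ι]

attribute [instance] FM.fin FM.dec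

namespace FM

variable {R : Type} [CommRing R]

instance instCat : Category (FM R) where
  Hom X Y := Matrix Y.ι X.ι R
  id X := (1 : Matrix X.ι X.ι R)
  comp {X Y Z} (f : Matrix Y.ι X.ι R) (g : Matrix Z.ι Y.ι R) := g * f
  id_comp {X Y} (f : Matrix Y.ι X.ι R) := Matrix.mul_one f
  comp_id {X Y} (f : Matrix Y.ι X.ι R) := Matrix.one_mul f
  assoc {X Y Z W} (f : Matrix Y.ι X.ι R) (g : Matrix Z.ι Y.ι R) (h : Matrix W.ι Z.ι R) :=
    (Matrix.mul_assoc h g f).symm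

instance instPre : Preadditive (FM R) where
  homGroup X Y := inferInstanceAs (AddCommGroup (Matrix Y.ι X.ι R))
  add_comp X Y Z (f f' : Matrix Y.ι X.ι R) (g : Matrix Z.ι Y.ι R) := Matrix.mul_add g f f'
  comp_add X Y Z (f : Matrix Y.ι X.ι R) (g g' : Matrix Z.ι Y.ι R) := Matrix.add_mul g g' f

/-- the matrix of a morphism -/
def mat {X Y : FM R} (f : X ⟶ Y) : Matrix Y.ι X.ι R := f

/-- the morphism of a matrix -/
def hom {X Y : FM R} (f : Matrix Y.ι X.ι R) : X ⟶ Y := f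

@[simp] lemma mat_hom {X Y : FM R} (f : Matrix Y.ι X.ι R) : mat (hom f : X ⟶ Y) = f := rfl
@[simp] lemma hom_mat {X Y : FM R} (f : X ⟶ Y) : hom (mat f) = f := rfl
@[simp] lemma mat_id (X : FM R) : mat (𝟙 X) = 1 := rfl
@[simp] lemma mat_comp {X Y Z : FM R} (f : X ⟶ Y) (g : Y ⟶ Z) :
    mat (f ≫ g) = mat g * mat f := rfl
@[simp] lemma mat_zero {X Y : FM R} : mat (0 : X ⟶ Y) = 0 := rfl
@[simp] lemma mat_add {X Y : FM R} (f g : X ⟶ Y) : mat (f + g) = mat f + mat g := rfl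
@[simp] lemma mat_neg {X Y : FM R} (f : X ⟶ Y) : mat (-f) = - mat f := rfl
lemma mat_inj {X Y : FM R} {f g : X ⟶ Y} (h : mat f = mat g) : f = g := h

/-- `mat` as an additive map -/
def matHom (X Y : FM R) : (X ⟶ Y) →+ Matrix Y.ι X.ι R where
  toFun := mat
  map_zero' := rfl
  map_add' _ _ := rfl

lemma mat_sum {X Y : FM R} {κ : Type} (s : Finset κ) (f : κ → (X ⟶ Y)) :
    mat (∑ k ∈ s, f k) = ∑ k ∈ s, mat (f k) := map_sum (matHom X Y) f s

lemma mat_zsmul {X Y : FM R} (k : ℤ) (f : X ⟶ Y) : mat (k • f) = k • mat f :=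
  map_zsmul (matHom X Y) k f

/-- scalar morphism -/
def scal (X : FM R) (y : R) : X ⟶ X := hom (y • (1 : Matrix X.ι X.ι R))

@[simp] lemma mat_scal (X : FM R) (y : R) : mat (scal X y) = y • (1 : Matrix X.ι X.ι R) := rfl

lemma scal_comp {X Y : FM R} (y : R) (f : X ⟶ Y) : scal X y ≫ f = f ≫ scal Y y := by
  apply mat_inj; simp

variable {A B : Type} [CommRing A] [CommRing B] [Algebra A B]

section E
variable (A)
variable (h : R →+* B) (M : Type) [AddCommGroup M] [Module B M] [Module A M] [IsScalarTower A B M]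

/-- action of a matrix on vectors in M -/
def act {κ ι : Type} [Fintype ι] (f : Matrix κ ι R) : (ι → M) →ₗ[A] (κ → M) where
  toFun v := fun i => ∑ j, h (f i j) • v j
  map_add' v w := by ext i; simp [smul_add, Finset.sum_add_distrib]
  map_smul' a v := by
    ext i
    simp only [Pi.smul_apply, RingHom.id_apply, Finset.smul_sum]
    exact Finset.sum_congr rfl fun j _ => smul_comm _ _ _

lemma act_apply {κ ι : Type} [Fintype ι] (f : Matrix κ ι R) (v : ι → M) (i : κ) :
    act A h M f v i = ∑ j, h (f i j) • v j := rfl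

lemma act_mul {κ ι ν : Type} [Fintype ι] [Fintype ν] (g : Matrix κ ν R) (f : Matrix ν ι R)
    (v : ι → M) : act A h M (g * f) v = act A h M g (act A h M f v) := by
  ext i
  simp only [act_apply, Matrix.mul_apply, map_sum, map_mul, Finset.sum_smul, Finset.smul_sum,
    mul_smul]
  rw [Finset.sum_comm]

lemma act_one {ι : Type} [Fintype ι] [DecidableEq ι] (v : ι → M) :
    act A h M (1 : Matrix ι ι R) v = v := by
  ext i
  simp [act_apply, Matrix.one_apply, apply_ite h]

/-- the evaluation functor -/
def E : FM R ⥤ ModuleCat.{0} A where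
  obj X := ModuleCat.of A (X.ι → M)
  map f := ModuleCat.ofHom (act A h M (mat f))
  map_id X := by
    exact ModuleCat.hom_ext (LinearMap.ext fun v => act_one A h M v)
  map_comp f g := by
    exact ModuleCat.hom_ext (LinearMap.ext fun v => act_mul A h M (mat g) (mat f) v)

lemma E_map {X Y : FM R} (f : X ⟶ Y) : (E A h M).map f = ModuleCat.ofHom (act A h M (mat f)) := rfl

instance E_add : (E A h M).Additive where
  map_add {X Y f g} := by
    refine ModuleCat.hom_ext (LinearMap.ext fun v => funext fun (i : Y.ι) => ?_)
    show ∑ j, h (mat f i j + mat g i j) • v j =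
      (∑ j, h (mat f i j) • v j) + ∑ j, h (mat g i j) • v j
    simp [add_smul, Finset.sum_add_distrib]

end E
end FM

section LES
variable {A : Type} [CommRing A]

lemma len_exact {X Y Z : Type} [AddCommGroup X] [AddCommGroup Y] [AddCommGroup Z]
    [Module A X] [Module A Y] [Module A Z] (f : X →ₗ[A] Y) (g : Y →ₗ[A] Z)
    (h : LinearMap.range f = LinearMap.ker g) :
    Module.length A Y = Module.length A (LinearMap.range f) + Module.length A (LinearMap.range g) := by
  refine Module.length_eq_add_of_exact (LinearMap.range f).subtype g.rangeRestrict
    (Submodule.injective_subtype _) g.surjective_rangeRestrict ?_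
  rw [LinearMap.exact_iff]
  simp [h]

lemma len_inj {X Y : Type} [AddCommGroup X] [AddCommGroup Y]
    [Module A X] [Module A Y] (f : X →ₗ[A] Y) :
    Module.length A (LinearMap.range f) ≤ Module.length A X :=
  Module.length_le_of_surjective f.rangeRestrict f.surjective_rangeRestrict

/-- length of homology -/
noncomputable def hl (C : ChainComplex (ModuleCat.{0} A) ℕ) (i : ℕ) : ℕ∞ := Module.length A (C.homology i)

theorem les (S : ShortComplex (ChainComplex (ModuleCat.{0} A) ℕ)) (hS : S.ShortExact) :
    ∃ r s a : ℕ → ℕ∞, a 0 = 0 ∧ (∀ i, hl S.X₁ i = a (i+1) + r i) ∧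
      (∀ i, hl S.X₂ i = r i + s i) ∧ (∀ i, hl S.X₃ i = s i + a i) ∧
      (∀ i, r i = Module.length A (LinearMap.range (HomologicalComplex.homologyMap S.f i).hom)) := by
  refine ⟨fun i => Module.length A (LinearMap.range (HomologicalComplex.homologyMap S.f i).hom),
    fun i => Module.length A (LinearMap.range (HomologicalComplex.homologyMap S.g i).hom),
    fun i => Nat.casesOn i 0 fun k =>
      Module.length A (LinearMap.range (hS.δ (k+1) k (by simp)).hom), rfl, ?_, ?_, ?_, fun i => rfl⟩
  · intro i
    have := hS.homology_exact₁ (i+1) i (by simp)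
    rw [ShortComplex.moduleCat_exact_iff_range_eq_ker] at this
    exact len_exact _ _ this
  · intro i
    have := hS.homology_exact₂ i
    rw [ShortComplex.moduleCat_exact_iff_range_eq_ker] at this
    exact len_exact _ _ this
  · intro i
    cases i with
    | zero =>
      have : Epi (HomologicalComplex.homologyMap S.g 0) := by
        have := hS.epi_g
        exact HomologicalComplex.epi_homologyMap_of_epi_of_not_rel _ _ (by simp)
      rw [ModuleCat.epi_iff_range_eq_top] at this
      show hl S.X₃ 0 = Module.length A (LinearMap.range (HomologicalComplex.homologyMap S.g 0).hom) + 0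
      rw [this, add_zero]
      exact (Submodule.topEquiv.length_eq).symm
    | succ i =>
      have := hS.homology_exact₃ (i+1) i (by simp)
      rw [ShortComplex.moduleCat_exact_iff_range_eq_ker] at this
      exact len_exact _ _ this

/-- finite sequences of lengths -/
def FS (l : ℕ → ℕ∞) : Prop := (∀ i, l i ≠ ⊤) ∧ ∃ N, ∀ i, N ≤ i → l i = 0

/-- alternating sum -/
noncomputable def chi (l : ℕ → ℕ∞) : ℤ := ∑ᶠ i, (-1 : ℤ) ^ i * ((l i).toNat : ℤ)

lemma chi_eq {l : ℕ → ℕ∞} {N : ℕ} (h : ∀ i, N ≤ i → l i = 0) :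
    chi l = ∑ i ∈ Finset.range N, (-1 : ℤ) ^ i * ((l i).toNat : ℤ) := by
  apply finsum_eq_sum_of_support_subset
  intro i hi
  simp only [Finset.coe_range, Set.mem_Iio]
  by_contra h'
  apply hi
  simp [h i (not_lt.1 h')]

/-- the numerical content of a long exact sequence -/
def Seq3 (x y z : ℕ → ℕ∞) : Prop := ∃ r s a : ℕ → ℕ∞, a 0 = 0 ∧ (∀ i, x i = a (i+1) + r i) ∧
      (∀ i, y i = r i + s i) ∧ (∀ i, z i = s i + a i)

namespace Seq3
variable {x y z : ℕ → ℕ∞}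

lemma fs1 (h : Seq3 x y z) (hy : FS y) (hz : FS z) : FS x := by
  obtain ⟨r, s, a, h0, hx', hy', hz'⟩ := h
  obtain ⟨hy1, N, hN⟩ := hy
  obtain ⟨hz1, K, hK⟩ := hz
  refine ⟨fun i => ?_, N + K, fun i hi => ?_⟩
  · have h1 := hy1 i
    have h2 := hz1 (i+1)
    rw [hy'] at h1
    rw [hz'] at h2
    simp only [ne_eq, ENat.add_eq_top, not_or, hx'] at *
    exact ⟨h2.2, h1.1⟩
  · have h1 := hN i (by omega)
    have h2 := hK (i+1) (by omega)
    rw [hy'] at h1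
    rw [hz'] at h2
    rw [add_eq_zero] at h1 h2
    rw [hx', h1.1, h2.2, add_zero]

lemma fs2 (h : Seq3 x y z) (hy : FS x) (hz : FS z) : FS y := by
  obtain ⟨r, s, a, h0, hx', hy', hz'⟩ := h
  obtain ⟨hy1, N, hN⟩ := hy
  obtain ⟨hz1, K, hK⟩ := hz
  refine ⟨fun i => ?_, N + K, fun i hi => ?_⟩
  · have h1 := hy1 i
    have h2 := hz1 i
    rw [hx'] at h1
    rw [hz'] at h2
    simp only [ne_eq, ENat.add_eq_top, not_or, hy'] at *
    exact ⟨h1.2, h2.1⟩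
  · have h1 := hN i (by omega)
    have h2 := hK i (by omega)
    rw [hx'] at h1
    rw [hz'] at h2
    rw [add_eq_zero] at h1 h2
    rw [hy', h1.2, h2.1, add_zero]

lemma fs3 (h : Seq3 x y z) (hy : FS x) (hz : FS y) : FS z := by
  obtain ⟨r, s, a, h0, hx', hy', hz'⟩ := h
  obtain ⟨hy1, N, hN⟩ := hy
  obtain ⟨hz1, K, hK⟩ := hz
  refine ⟨fun i => ?_, N + K + 1, fun i hi => ?_⟩
  · have h2 := hz1 i
    rw [hy'] at h2
    rw [hz']
    cases i with
    | zero => simp only [ne_eq, ENat.add_eq_top, not_or, h0] at *; simp [h2.2]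
    | succ i =>
      have h1 := hy1 i
      rw [hx'] at h1
      simp only [ne_eq, ENat.add_eq_top, not_or] at *
      exact ⟨h2.2, h1.1⟩
  · obtain ⟨j, rfl⟩ : ∃ j, i = j + 1 := ⟨i - 1, by omega⟩
    have h1 := hN j (by omega)
    have h2 := hK (j+1) (by omega)
    rw [hx'] at h1
    rw [hy'] at h2
    rw [add_eq_zero] at h1 h2
    rw [hz', h1.1, h2.2, add_zero]

lemma chi_add (h : Seq3 x y z) (hx : FS x) (hy : FS y) (hz : FS z) : chi y = chi x + chi z := by
  obtain ⟨r, s, a, h0, hx', hy', hz'⟩ := h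
  obtain ⟨hx1, N1, hN1⟩ := hx
  obtain ⟨hy1, N2, hN2⟩ := hy
  obtain ⟨hz1, N3, hN3⟩ := hz
  have key : ∀ N, ∑ i ∈ Finset.range N, (-1 : ℤ) ^ i * ((x i).toNat : ℤ)
      + ∑ i ∈ Finset.range N, (-1 : ℤ) ^ i * ((z i).toNat : ℤ)
      - ∑ i ∈ Finset.range N, (-1 : ℤ) ^ i * ((y i).toNat : ℤ) = - (-1 : ℤ) ^ N * (a N).toNat := by
    intro N
    induction N with
    | zero => simp [h0]
    | succ N ih =>
      rw [Finset.sum_range_succ, Finset.sum_range_succ, Finset.sum_range_succ]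
      have h1 := hx1 N
      have h2 := hy1 N
      have h3 := hz1 N
      rw [hx'] at h1
      rw [hy'] at h2
      rw [hz'] at h3
      simp only [ne_eq, ENat.add_eq_top, not_or] at h1 h2 h3
      have e1 : (x N).toNat = (a (N+1)).toNat + (r N).toNat := by
        rw [hx', ENat.toNat_add h1.1 h1.2]
      have e2 : (y N).toNat = (r N).toNat + (s N).toNat := by
        rw [hy', ENat.toNat_add h2.1 h2.2]
      have e3 : (z N).toNat = (s N).toNat + (a N).toNat := by
        rw [hz', ENat.toNat_add h3.1 h3.2]
      rw [e1, e2, e3]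
      push_cast
      rw [pow_succ]
      linear_combination ih
  have := key (N1 + N2 + N3)
  rw [chi_eq (N := N1 + N2 + N3) fun i hi => hN1 i (by omega),
    chi_eq (N := N1 + N2 + N3) fun i hi => hN2 i (by omega),
    chi_eq (N := N1 + N2 + N3) fun i hi => hN3 i (by omega)]
  have h3 := hN3 (N1 + N2 + N3) (by omega)
  rw [hz', add_eq_zero] at h3
  rw [h3.2] at this
  simp at this
  linarith

end Seq3

lemma les' (S : ShortComplex (ChainComplex (ModuleCat.{0} A) ℕ)) (hS : S.ShortExact) :
    Seq3 (hl S.X₁) (hl S.X₂) (hl S.X₃) := by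
  obtain ⟨r, s, a, h0, h1, h2, h3, -⟩ := les S hS
  exact ⟨r, s, a, h0, h1, h2, h3⟩

/-- degreewise exactness -/
lemma shortExact_mk {X Y Z : ChainComplex (ModuleCat.{0} A) ℕ} (f : X ⟶ Y) (g : Y ⟶ Z)
    (inj : ∀ i, Function.Injective (f.f i).hom) (surj : ∀ i, Function.Surjective (g.f i).hom)
    (ex : ∀ i, Function.Exact (f.f i).hom (g.f i).hom) :
    ∃ w, (ShortComplex.mk f g w).ShortExact := by
  refine ⟨?_, ?_⟩
  · ext i x
    exact (ex i).apply_apply_eq_zero x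
  · apply HomologicalComplex.shortExact_of_degreewise_shortExact
    intro i
    exact ModuleCat.shortComplex_shortExact _ (ex i) (inj i) (surj i)

lemma hl_iso {X Y : ChainComplex (ModuleCat.{0} A) ℕ} (e : X ≅ Y) : hl X = hl Y := by
  funext i
  exact (((HomologicalComplex.homologyFunctor _ _ i).mapIso e).toLinearEquiv).length_eq

lemma hl_hequiv {X Y : ChainComplex (ModuleCat.{0} A) ℕ} (e : HomotopyEquiv X Y) : hl X = hl Y := by
  funext i
  exact ((e.toHomologyIso i).toLinearEquiv).length_eq

lemma seq3_mk {X Y Z : ChainComplex (ModuleCat.{0} A) ℕ} (f : X ⟶ Y) (g : Y ⟶ Z)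
    (inj : ∀ i, Function.Injective (f.f i).hom) (surj : ∀ i, Function.Surjective (g.f i).hom)
    (ex : ∀ i, Function.Exact (f.f i).hom (g.f i).hom) : Seq3 (hl X) (hl Y) (hl Z) := by
  obtain ⟨w, h⟩ := shortExact_mk f g inj surj ex
  exact les' _ h

end LES

end

section
open CategoryTheory

section Cpx
variable {A : Type} [CommRing A] {𝒞 : Type 1} [Category.{0} 𝒞]

/-- the complex obtained by applying a functor to a simplicial object -/
noncomputable def CC (Φ : 𝒞 ⥤ ModuleCat.{0} A) (X : SimplicialObject 𝒞) :
    ChainComplex (ModuleCat.{0} A) ℕ :=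
  (AlgebraicTopology.alternatingFaceMapComplex (ModuleCat.{0} A)).obj
    (((SimplicialObject.whiskering _ _).obj Φ).obj X)

/-- its functoriality -/
noncomputable def CCmap {Φ Ψ : 𝒞 ⥤ ModuleCat.{0} A} (η : Φ ⟶ Ψ) (X : SimplicialObject 𝒞) :
    CC Φ X ⟶ CC Ψ X :=
  (AlgebraicTopology.alternatingFaceMapComplex (ModuleCat.{0} A)).map
    (((SimplicialObject.whiskering _ _).map η).app X)

lemma CCmap_f {Φ Ψ : 𝒞 ⥤ ModuleCat.{0} A} (η : Φ ⟶ Ψ) (X : SimplicialObject 𝒞) (i : ℕ) :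
    (CCmap η X).f i = η.app (X.obj (Opposite.op (SimplexCategory.mk i))) := rfl

lemma CC_seq {Φ Ψ Ξ : 𝒞 ⥤ ModuleCat.{0} A} (η : Φ ⟶ Ψ) (θ : Ψ ⟶ Ξ) (X : SimplicialObject 𝒞)
    (inj : ∀ Y, Function.Injective (η.app Y).hom) (surj : ∀ Y, Function.Surjective (θ.app Y).hom)
    (ex : ∀ Y, Function.Exact (η.app Y).hom (θ.app Y).hom) :
    Seq3 (hl (CC Φ X)) (hl (CC Ψ X)) (hl (CC Ξ X)) :=
  seq3_mk (CCmap η X) (CCmap θ X) (fun i => inj _) (fun i => surj _) (fun i => ex _)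

lemma CC_bij {Φ Ψ : 𝒞 ⥤ ModuleCat.{0} A} (η : Φ ⟶ Ψ) (X : SimplicialObject 𝒞)
    (bij : ∀ Y, Function.Bijective (η.app Y).hom) : hl (CC Φ X) = hl (CC Ψ X) := by
  have : ∀ Y, IsIso (η.app Y) := fun Y => (ConcreteCategory.isIso_iff_bijective _).2 (bij Y)
  have : IsIso η := NatIso.isIso_of_isIso_app η
  exact hl_iso ((AlgebraicTopology.alternatingFaceMapComplex (ModuleCat.{0} A)).mapIso
    (((SimplicialObject.whiskering _ _).mapIso (asIso η)).app X))

/-- subfunctors -/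
def subF (Φ : 𝒞 ⥤ ModuleCat.{0} A) (S : ∀ X, Submodule A (Φ.obj X))
    (hS : ∀ {X Y} (f : X ⟶ Y) x, x ∈ S X → (Φ.map f).hom x ∈ S Y) : 𝒞 ⥤ ModuleCat.{0} A where
  obj X := ModuleCat.of A (S X)
  map f := ModuleCat.ofHom ((Φ.map f).hom.restrict (hS f))
  map_id X := by
    refine ModuleCat.hom_ext (LinearMap.ext fun v => Subtype.ext ?_)
    simp
  map_comp f g := by
    refine ModuleCat.hom_ext (LinearMap.ext fun v => Subtype.ext ?_)
    simp

/-- maps of subfunctors -/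
def subM {Φ Ψ : 𝒞 ⥤ ModuleCat.{0} A} (η : Φ ⟶ Ψ) {S : ∀ X, Submodule A (Φ.obj X)}
    {hS : ∀ {X Y} (f : X ⟶ Y) x, x ∈ S X → (Φ.map f).hom x ∈ S Y}
    {S' : ∀ X, Submodule A (Ψ.obj X)}
    {hS' : ∀ {X Y} (f : X ⟶ Y) x, x ∈ S' X → (Ψ.map f).hom x ∈ S' Y}
    (h : ∀ X x, x ∈ S X → (η.app X).hom x ∈ S' X) :
    subF Φ S hS ⟶ subF Ψ S' hS' where
  app X := ModuleCat.ofHom ((η.app X).hom.restrict (h X))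
  naturality X Y f := by
    refine ModuleCat.hom_ext (LinearMap.ext fun v => Subtype.ext ?_)
    exact congrArg (fun k => k.hom v.1) (η.naturality f)

end Cpx

section Ring

lemma poly_id (p : ℕ) [Fact p.Prime] {S : Type} [Ring S] (hp : (p : S) = 0) (x : S) :
    (x - 1) ^ (p - 1) = ∑ i ∈ Finset.range p, x ^ i := by
  letI : Algebra (ZMod p) S := ZMod.algebra' S (ringChar S) (ringChar.dvd hp)
  have key : ((Polynomial.X : Polynomial (ZMod p)) - 1) ^ (p - 1) =
      ∑ i ∈ Finset.range p, Polynomial.X ^ i := by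
    have hne : (Polynomial.X : Polynomial (ZMod p)) - 1 ≠ 0 := by
      simpa using Polynomial.X_sub_C_ne_zero (1 : ZMod p)
    apply mul_right_cancel₀ hne
    rw [geom_sum_mul, ← pow_succ, Nat.sub_add_cancel (Fact.out : p.Prime).one_le, sub_pow_char]
    simp
  have := congrArg (Polynomial.aeval x) key
  simpa using this

lemma poly_id' (p : ℕ) [Fact p.Prime] {S : Type} [Ring S] (hp : (p : S) = 0) (x : S) (hx : x ^ p = 1) :
    (x - 1) ^ p = 0 := by
  rw [← Nat.sub_add_cancel (Fact.out : p.Prime).one_le, pow_succ, poly_id p hp, geom_sum_mul, hx,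
    sub_self]

lemma sum_range_zmod (p : ℕ) [Fact p.Prime] {S : Type} [AddCommMonoid S] (f : ZMod p → S) :
    ∑ i ∈ Finset.range p, f (i : ZMod p) = ∑ c, f c := by
  refine Finset.sum_bij' (fun i _ => (i : ZMod p)) (fun c _ => c.val) ?_ ?_ ?_ ?_ ?_
  · simp
  · intro c _; simp [ZMod.val_lt]
  · intro i hi; exact ZMod.val_cast_of_lt (Finset.mem_range.1 hi)
  · simp
  · simp
end Ring

section Shift
variable (p : ℕ) [Fact p.Prime] {ι : Type}

/-- shift -/
def shc (c : ZMod p) (a : ZMod p → ι) : ZMod p → ι := fun k => a (k + c)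

@[simp] lemma shc_zero (a : ZMod p → ι) : shc p 0 a = a := by ext k; simp [shc]
lemma shc_shc (c d : ZMod p) (a : ZMod p → ι) : shc p c (shc p d a) = shc p (c + d) a := by
  ext k; simp [shc, add_assoc]
@[simp] lemma shc_const (c : ZMod p) (i : ι) : shc p c (fun _ => i) = fun _ => i := rfl

/-- shift as a permutation -/
def shE (c : ZMod p) : (ZMod p → ι) ≃ (ZMod p → ι) where
  toFun := shc p c
  invFun := shc p (-c)
  left_inv a := by simp [shc_shc]
  right_inv a := by simp [shc_shc]

/-- orbit relation -/
def orb (ι : Type) : Setoid (ZMod p → ι) where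
  r a b := ∃ c, b = shc p c a
  iseqv := ⟨fun a => ⟨0, by simp⟩, fun {a b} ⟨c, h⟩ => ⟨-c, by simp [h, shc_shc]⟩,
    fun {a b d} ⟨c, h⟩ ⟨c', h'⟩ => ⟨c' + c, by simp [h, h', shc_shc]⟩⟩

/-- orbits -/
def Orb (ι : Type) : Type := Quotient (orb p ι)

/-- orbit map -/
def omk (a : ZMod p → ι) : Orb p ι := Quotient.mk (orb p ι) a

/-- representative -/
noncomputable def oout (o : Orb p ι) : ZMod p → ι := Quotient.out o

@[simp] lemma omk_oout (o : Orb p ι) : omk p (oout p o) = o := Quotient.out_eq _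

lemma omk_eq {a b : ZMod p → ι} : omk p a = omk p b ↔ ∃ c, b = shc p c a := by
  exact Quotient.eq (r := orb p ι)

@[simp] lemma omk_shc (c : ZMod p) (a : ZMod p → ι) : omk p (shc p c a) = omk p a :=
  ((omk_eq p).2 ⟨c, rfl⟩).symm

noncomputable instance [Fintype ι] [DecidableEq ι] : Fintype (Orb p ι) :=
  letI := Classical.decRel (orb p ι).r
  inferInstanceAs (Fintype (Quotient (orb p ι)))

noncomputable instance [DecidableEq ι] : DecidableEq (Orb p ι) := Classical.decEq _

lemma shc_const_of_eq {a : ZMod p → ι} {c : ZMod p} (hc : c ≠ 0) (h : shc p c a = a) :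
    a = fun _ => a 0 := by
  have key : ∀ m : ℕ, a (m * c) = a 0 := by
    intro m
    induction m with
    | zero => simp
    | succ m ih =>
      have := congrFun h (m * c)
      rw [← ih, ← this]
      simp [shc, add_mul]
  ext k
  have := key (k * c⁻¹).val
  rw [← this]
  simp [hc]

lemma exists_unique_shc {a : ZMod p → ι} (h : ¬ ∃ i, a = fun _ => i) :
    ∃! c, shc p c a = oout p (omk p a) := by
  obtain ⟨c, hc⟩ := (omk_eq p).1 (omk_oout p (omk p a)).symm
  refine ⟨c, hc.symm, fun d hd => ?_⟩
  dsimp at hd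
  by_contra hne
  apply h
  refine ⟨a 0, shc_const_of_eq p (c := d - c) (sub_ne_zero.2 hne) ?_⟩
  have := hc ▸ hd
  apply (shE p c).injective
  change shc p c (shc p (d - c) a) = shc p c a
  rw [shc_shc, ← this]
  congr 1
  ring

variable {B : Type} [CommRing B] (hB : (p : B) = 0)
variable (A : Type) [CommRing A] [Algebra A B]

/-- shift operator on functions -/
def sg (ι : Type) : Module.End A ((ZMod p → ι) → B) where
  toFun v := fun a => v (shc p 1 a)
  map_add' _ _ := rfl
  map_smul' _ _ := rfl

lemma sg_pow (i : ℕ) (v : (ZMod p → ι) → B) (a : ZMod p → ι) :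
    ((sg p A ι) ^ i) v a = v (shc p i a) := by
  induction i generalizing v with
  | zero => simp
  | succ i ih =>
    rw [pow_succ, Module.End.mul_apply, ih]
    show v (shc p 1 (shc p i a)) = _
    rw [shc_shc]
    congr 2
    push_cast
    ring

include hB in
lemma end_p : ((p : ℕ) : Module.End A ((ZMod p → ι) → B)) = 0 := by
  ext v a
  have : ((p : ℕ) : Module.End A ((ZMod p → ι) → B)) v a = (p : B) * v a := by
    rw [← nsmul_one, LinearMap.smul_apply, Module.End.one_apply, Pi.smul_apply, nsmul_eq_mul]
  rw [this, hB]; simp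

include hB in
lemma t_pow_p : ((sg p A ι : Module.End A ((ZMod p → ι) → B)) - 1) ^ p = 0 := by
  apply poly_id' p (end_p p hB A)
  ext v a
  rw [sg_pow]; simp

include hB in
lemma t_pow_p1 (v : (ZMod p → ι) → B) (a) :
    ((((sg p A ι : Module.End A ((ZMod p → ι) → B)) - 1) ^ (p - 1)) v) a = ∑ c, v (shc p c a) := by
  rw [poly_id p (end_p p hB A), ← sum_range_zmod p, LinearMap.sum_apply, Finset.sum_apply]
  exact Finset.sum_congr rfl fun i _ => sg_pow p A i v a

/-- invariant functions vanishing on constants are norms -/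
lemma inv_norm (u : (ZMod p → ι) → B) (hu : ∀ a, u (shc p 1 a) = u a) (hu0 : ∀ i, u (fun _ => i) = 0) :
    ∃ w : (ZMod p → ι) → B, ∀ a, u a = ∑ c, w (shc p c a) := by
  classical
  have hu' : ∀ (c : ZMod p) a, u (shc p c a) = u a := by
    intro c a
    rw [← ZMod.natCast_zmod_val c]
    induction c.val with
    | zero => simp
    | succ m ih =>
      rw [← ih, ← hu (shc p m a), shc_shc]
      congr 2
      push_cast
      ring
  refine ⟨fun a => if a = oout p (omk p a) then u a else 0, fun a => ?_⟩
  by_cases h : ∃ i, a = fun _ => i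
  · obtain ⟨i, rfl⟩ := h
    simp [hu0]
  · obtain ⟨c, hc, huniq⟩ := exists_unique_shc p h
    rw [Finset.sum_eq_single c]
    · simp only [omk_shc, hu']
      rw [if_pos hc]
    · intro d _ hd
      dsimp only
      rw [if_neg]
      rw [omk_shc]
      exact fun h => hd (huniq d h)
    · simp

include hB in
lemma sum_inv [Fintype ι] [DecidableEq ι] (g : (ZMod p → ι) → B) (hg : ∀ a, g (shc p 1 a) = g a) :
    ∑ a, g a = ∑ i, g (fun _ => i) := by
  classical
  obtain ⟨w, hw⟩ := inv_norm p (fun a => g a - if ∃ i, a = fun _ => i then g a else 0)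
    (by
      intro a
      simp only [hg]
      congr 2
      apply propext
      refine exists_congr fun i => ?_
      constructor
      · intro h
        have := congrArg (shc p (-1)) h
        rw [shc_shc] at this
        simpa using this
      · rintro rfl; rfl)
    (by intro i; rw [if_pos ⟨i, rfl⟩, sub_self])
  have h1 : ∑ a, (g a - if ∃ i, a = fun _ => i then g a else 0) = 0 := by
    rw [Finset.sum_congr rfl fun a _ => hw a, Finset.sum_comm]
    have : ∀ c, ∑ a, w (shc p c a) = ∑ a, w a := fun c => (shE p c).sum_comp w
    rw [Finset.sum_congr rfl fun c _ => this c]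
    simp [hB]
  rw [Finset.sum_sub_distrib, sub_eq_zero] at h1
  rw [h1, ← Finset.sum_filter]
  symm
  apply Finset.sum_bij (fun i _ => fun _ => i)
  · intro i _
    exact Finset.mem_filter.2 ⟨Finset.mem_univ _, i, rfl⟩
  · intro i _ j _ h; exact congrFun h 0
  · intro a ha
    simp only [Finset.mem_filter, Finset.mem_univ, true_and] at ha
    obtain ⟨i, rfl⟩ := ha
    exact ⟨i, by simp, rfl⟩
  · simp

end Shift

end

section
open CategoryTheory

namespace FM
variable (p : ℕ) [Fact p.Prime] {R : Type} [CommRing R]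

/-- Tensor power of a matrix. -/
def Tm {κ ι : Type} (M : Matrix κ ι R) : Matrix (ZMod p → κ) (ZMod p → ι) R :=
  fun a b => ∏ k, M (a k) (b k)

lemma Tm_mul {κ ι ν : Type} [Fintype ν] [DecidableEq ν] (M : Matrix κ ν R) (N : Matrix ν ι R) :
    Tm p (M * N) = Tm p M * Tm p N := by
  ext a b
  simp only [Tm, Matrix.mul_apply, Finset.prod_univ_sum, Fintype.piFinset_univ,
    Finset.prod_mul_distrib]

lemma Tm_smul_one {ι : Type} [Fintype ι] [DecidableEq ι] (y : R) :
    Tm p (y • (1 : Matrix ι ι R)) = y ^ p • 1 := by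
  ext a b
  simp only [Tm, Matrix.smul_apply, Matrix.one_apply, smul_eq_mul, mul_ite, mul_one, mul_zero]
  by_cases h : a = b
  · subst h; simp
  · rw [if_neg h]
    obtain ⟨k, hk⟩ := Function.ne_iff.1 h
    exact Finset.prod_eq_zero (Finset.mem_univ k) (if_neg hk)

lemma Tm_one {ι : Type} [Fintype ι] [DecidableEq ι] : Tm p (1 : Matrix ι ι R) = 1 := by
  simpa using Tm_smul_one p (ι := ι) (1 : R)

lemma Tm_zero {κ ι : Type} : Tm p (0 : Matrix κ ι R) = 0 := by
  ext a b
  simp [Tm, (Fact.out : p.Prime).ne_zero]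

/-- shift-invariant matrices -/
def Inv {κ ι : Type} (N : Matrix (ZMod p → κ) (ZMod p → ι) R) : Prop :=
  ∀ c a b, N (shc p c a) (shc p c b) = N a b

lemma Tm_inv {κ ι : Type} (M : Matrix κ ι R) : Inv p (Tm p M) := by
  intro c a b
  exact Equiv.prod_comp (Equiv.addRight c) fun k => M (a k) (b k)

/-- orbit matrix -/
noncomputable def Pm {κ ι : Type} [Fintype ι] [DecidableEq ι] (N : Matrix (ZMod p → κ) (ZMod p → ι) R) :
    Matrix (Orb p κ) (Orb p ι) R := fun o' o => ∑ b, if omk p b = o then N (oout p o') b else 0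

lemma Pm_mk {κ ι : Type} [Fintype ι] [DecidableEq ι] {N : Matrix (ZMod p → κ) (ZMod p → ι) R}
    (hN : Inv p N) (a : ZMod p → κ) (o : Orb p ι) :
    Pm p N (omk p a) o = ∑ b, if omk p b = o then N a b else 0 := by
  obtain ⟨c, hc⟩ := (omk_eq p).1 (omk_oout p (omk p a)).symm
  unfold Pm
  rw [hc, ← (shE p c).sum_comp]
  refine Finset.sum_congr rfl fun b _ => ?_
  change (if omk p (shc p c b) = o then N (shc p c a) (shc p c b) else 0) = _
  rw [omk_shc, hN]

lemma sum_orb {S : Type} [AddCommMonoid S] {ι : Type} [Fintype ι] [DecidableEq ι]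
    (f : (ZMod p → ι) → S) : ∑ a, f a = ∑ o : Orb p ι, ∑ a, if omk p a = o then f a else 0 := by
  rw [Finset.sum_comm]
  simp

lemma Pm_mul {κ ι ν : Type} [Fintype ν] [DecidableEq ν] [Fintype ι] [DecidableEq ι]
    {M : Matrix (ZMod p → κ) (ZMod p → ν) R} {N : Matrix (ZMod p → ν) (ZMod p → ι) R}
    (hN : Inv p N) : Pm p (M * N) = Pm p M * Pm p N := by
  ext o' o
  rw [Matrix.mul_apply]
  have e1 : Pm p (M * N) o' o = ∑ c, M (oout p o') c * Pm p N (omk p c) o := by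
    unfold Pm
    simp only [Matrix.mul_apply]
    calc _ = ∑ b, ∑ c, M (oout p o') c * (if omk p b = o then N c b else 0) := by
          refine Finset.sum_congr rfl fun b _ => ?_
          split_ifs <;> simp
      _ = ∑ c, M (oout p o') c * ∑ b, (if omk p b = o then N c b else 0) := by
          rw [Finset.sum_comm]
          simp [Finset.mul_sum]
      _ = _ := by
          refine Finset.sum_congr rfl fun c _ => ?_
          rw [← Pm_mk p hN]
          rfl
  rw [e1, sum_orb p]
  refine Finset.sum_congr rfl fun o'' _ => ?_
  show _ = (∑ c, if omk p c = o'' then M (oout p o') c else 0) * _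
  rw [Finset.sum_mul]
  refine Finset.sum_congr rfl fun c _ => ?_
  split_ifs with h
  · rw [h]
  · simp

lemma Pm_smul_one {ι : Type} [Fintype ι] [DecidableEq ι] (y : R) :
    Pm p (y • (1 : Matrix (ZMod p → ι) (ZMod p → ι) R)) = y • 1 := by
  ext o' o
  simp only [Pm, Matrix.smul_apply, Matrix.one_apply, smul_eq_mul, mul_ite, mul_one, mul_zero]
  rw [Finset.sum_eq_single (oout p o')]
  · simp
  · intro b _ hb
    simp [hb.symm]
  · simp

lemma Pm_one {ι : Type} [Fintype ι] [DecidableEq ι] :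
    Pm p (1 : Matrix (ZMod p → ι) (ZMod p → ι) R) = 1 := by
  simpa using Pm_smul_one p (ι := ι) (1 : R)

lemma Pm_zero {κ ι : Type} [Fintype ι] [DecidableEq ι] :
    Pm p (0 : Matrix (ZMod p → κ) (ZMod p → ι) R) = 0 := by
  ext a b; simp [Pm]

lemma Pm_sum {κ ι : Type} [Fintype ι] [DecidableEq ι] {ν : Type} (s : Finset ν)
    (f : ν → Matrix (ZMod p → κ) (ZMod p → ι) R) : Pm p (∑ k ∈ s, f k) = ∑ k ∈ s, Pm p (f k) := by
  ext a b
  simp only [Pm, Matrix.sum_apply]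
  rw [Finset.sum_comm]
  refine Finset.sum_congr rfl fun b _ => ?_
  split_ifs <;> simp

variable (R)

/-- tensor power functor -/
def TF : FM R ⥤ FM R where
  obj X := ⟨ZMod p → X.ι⟩
  map f := hom (Tm p (mat f))
  map_id X := mat_inj (Tm_one p)
  map_comp f g := mat_inj (Tm_mul p (mat g) (mat f))

/-- orbit functor -/
noncomputable def PF : FM R ⥤ FM R where
  obj X := ⟨Orb p X.ι⟩
  map f := hom (Pm p (Tm p (mat f)))
  map_id X := mat_inj (by
    show Pm p (Tm p (1 : Matrix X.ι X.ι R)) = 1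
    rw [Tm_one, Pm_one])
  map_comp f g := mat_inj (by
    show Pm p (Tm p (mat g * mat f)) = Pm p (Tm p (mat g)) * Pm p (Tm p (mat f))
    rw [Tm_mul, Pm_mul p (Tm_inv p (mat f))])

variable {R}
variable {A B : Type} [CommRing A] [CommRing B] [Algebra A B] (h : R →+* B) (hB : (p : B) = 0)

/-- t -/
def tt (ι : Type) : Module.End A ((ZMod p → ι) → B) := sg p A ι - 1

lemma tt_apply {ι : Type} (v : (ZMod p → ι) → B) (a) :
    (tt p ι : Module.End A _) v a = v (shc p 1 a) - v a := rfl

lemma act_sg {X Y : FM R} (f : X ⟶ Y) (v : (ZMod p → X.ι) → B) :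
    act A h B (Tm p (mat f)) ((tt p X.ι : Module.End A _) v) =
      (tt p Y.ι : Module.End A _) (act A h B (Tm p (mat f)) v) := by
  ext a
  rw [tt_apply, act_apply, act_apply, act_apply]
  simp only [tt_apply, smul_sub, Finset.sum_sub_distrib]
  congr 1
  rw [← (shE p 1).sum_comp fun b => h (Tm p (mat f) (shc p 1 a) b) • v b]
  refine Finset.sum_congr rfl fun b _ => ?_
  change _ = h (Tm p (mat f) (shc p 1 a) (shc p 1 b)) • _
  rw [Tm_inv]
  rfl

lemma act_tt {X Y : FM R} (f : X ⟶ Y) (j : ℕ) (v : (ZMod p → X.ι) → B) :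
    act A h B (Tm p (mat f)) (((tt p X.ι : Module.End A _) ^ j) v) =
      ((tt p Y.ι : Module.End A _) ^ j) (act A h B (Tm p (mat f)) v) := by
  induction j generalizing v with
  | zero => rfl
  | succ j ih => rw [pow_succ, pow_succ, Module.End.mul_apply, Module.End.mul_apply, ih, act_sg]

variable (A) in
/-- tensor power functor followed by evaluation -/
abbrev VF : FM R ⥤ ModuleCat.{0} A := TF p R ⋙ E A h B

/-- t^j as natural transformation -/
def tN (j : ℕ) : VF p A h ⟶ VF p A h where
  app X := ModuleCat.ofHom ((tt p X.ι : Module.End A _) ^ j)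
  naturality X Y f := ModuleCat.hom_ext (LinearMap.ext fun v => (act_tt p h f j v).symm)

/-- kernel submodule -/
def KS (j : ℕ) (X : FM R) : Submodule A ((VF p A h).obj X) :=
  LinearMap.ker ((tt p X.ι : Module.End A ((ZMod p → X.ι) → B)) ^ j)

lemma mem_KS {j : ℕ} {X : FM R} {v : (ZMod p → X.ι) → B} :
    v ∈ KS (A := A) p h j X ↔ ((tt p X.ι : Module.End A _) ^ j) v = 0 := Iff.rfl

lemma mem_KS1 {X : FM R} {v : (ZMod p → X.ι) → B} :
    v ∈ KS (A := A) p h 1 X ↔ ∀ a, v (shc p 1 a) = v a := by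
  rw [mem_KS, pow_one, funext_iff]
  exact forall_congr' fun a => by rw [tt_apply]; exact sub_eq_zero

lemma KS_map (j : ℕ) {X Y : FM R} (f : X ⟶ Y) (v : (VF p A h).obj X) (hv : v ∈ KS p h j X) :
    ((VF p A h).map f).hom v ∈ KS p h j Y := by
  have h1 := act_tt (A := A) p h f j v
  have h2 : ((tt p X.ι : Module.End A ((ZMod p → X.ι) → B)) ^ j) v = 0 := hv
  rw [h2, map_zero] at h1
  exact h1.symm

variable (A) in
/-- kernel functor -/
def KF (j : ℕ) : FM R ⥤ ModuleCat.{0} A := subF (VF p A h) (KS p h j) (KS_map p h j)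

include hB in
lemma act_const {X Y : FM R} (f : X ⟶ Y) (v : (ZMod p → X.ι) → B) (hv : ∀ a, v (shc p 1 a) = v a)
    (i : Y.ι) : act A h B (Tm p (mat f)) v (fun _ => i) = ∑ j, h (mat f i j) ^ p • v (fun _ => j) := by
  rw [act_apply, sum_inv p hB]
  · simp [Tm]
  · intro a
    rw [hv]
    have := Tm_inv p (mat f) 1 (fun _ => i) a
    rw [shc_const] at this
    rw [this]

/-- invariants vanishing on constants -/
def IS (X : FM R) : Submodule A ((VF p A h).obj X) where
  carrier := {v : (ZMod p → X.ι) → B | v ∈ KS (A := A) p h 1 X ∧ ∀ i, v (fun _ => i) = 0}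
  add_mem' {v w} hv hw := ⟨add_mem hv.1 hw.1, fun i => by
    change v (fun _ => i) + w (fun _ => i) = 0
    rw [hv.2, hw.2, add_zero]⟩
  zero_mem' := ⟨zero_mem _, fun i => rfl⟩
  smul_mem' a v hv := ⟨Submodule.smul_mem _ a hv.1, fun i => by
    change a • v (fun _ => i) = 0
    rw [hv.2, smul_zero]⟩

lemma mem_IS {X : FM R} {v : (ZMod p → X.ι) → B} :
    v ∈ IS (A := A) p h X ↔ v ∈ KS (A := A) p h 1 X ∧ ∀ i, v (fun _ => i) = 0 := Iff.rfl

include hB in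
lemma IS_map {X Y : FM R} (f : X ⟶ Y) (v : (VF p A h).obj X) (hv : v ∈ IS p h X) :
    ((VF p A h).map f).hom v ∈ IS p h Y := by
  refine ⟨KS_map p h 1 f v hv.1, fun i => ?_⟩
  change act A h B (Tm p (mat f)) v (fun _ => i) = 0
  rw [act_const p h hB f v ((mem_KS1 (A := A) p h).1 hv.1)]
  exact Finset.sum_eq_zero fun j _ => by rw [hv.2, smul_zero]

variable (A) in
/-- functor I -/
def IF : FM R ⥤ ModuleCat.{0} A := subF (VF p A h) (IS p h) (IS_map p h hB)

/-- inclusion K_j -> K_{j+1} -/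
def KK (j : ℕ) : KF p A h j ⟶ KF p A h (j+1) :=
  subM (𝟙 _) fun X (v : (ZMod p → X.ι) → B) hv => by
    change ((tt p X.ι : Module.End A ((ZMod p → X.ι) → B)) ^ (j+1)) v = 0
    have h2 : ((tt p X.ι : Module.End A ((ZMod p → X.ι) → B)) ^ j) v = 0 := hv
    rw [pow_succ', Module.End.mul_apply, h2, map_zero]

/-- t^j : K_{j+1} -> I -/
def KI (j : ℕ) (hj : 1 ≤ j) : KF p A h (j+1) ⟶ IF p A h hB :=
  subM (tN p h j) fun X (v : (ZMod p → X.ι) → B) hv => by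
    have h2 : ((tt p X.ι : Module.End A ((ZMod p → X.ι) → B)) ^ (j+1)) v = 0 := hv
    refine ⟨?_, fun i => ?_⟩
    · change ((tt p X.ι : Module.End A ((ZMod p → X.ι) → B)) ^ 1)
        (((tt p X.ι : Module.End A ((ZMod p → X.ι) → B)) ^ j) v) = 0
      rw [pow_succ', Module.End.mul_apply] at h2
      rw [pow_one, h2]
    · change (((tt p X.ι : Module.End A ((ZMod p → X.ι) → B)) ^ j) v) (fun _ => i) = 0
      obtain ⟨k, rfl⟩ : ∃ k, j = k + 1 := ⟨j - 1, by omega⟩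
      rw [pow_succ', Module.End.mul_apply, tt_apply, shc_const, sub_self]

include hB in
lemma surjI {ι : Type} (u : (ZMod p → ι) → B) (hu : ∀ a, u (shc p 1 a) = u a)
    (hu0 : ∀ i, u (fun _ => i) = 0) (j : ℕ) (hjp : j < p) :
    ∃ w, ((tt p ι : Module.End A ((ZMod p → ι) → B)) ^ (j+1)) w = 0 ∧
      ((tt p ι : Module.End A ((ZMod p → ι) → B)) ^ j) w = u := by
  obtain ⟨w, hw⟩ := inv_norm p u hu hu0
  have e : u = ((tt p ι : Module.End A ((ZMod p → ι) → B)) ^ (p - 1)) w := by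
    ext a
    rw [hw a]
    exact (t_pow_p1 p hB A w a).symm
  refine ⟨((tt p ι : Module.End A ((ZMod p → ι) → B)) ^ (p - 1 - j)) w, ?_, ?_⟩
  · rw [← Module.End.mul_apply, ← pow_add]
    have : j + 1 + (p - 1 - j) = p := by omega
    rw [this]
    exact congrArg (fun k : Module.End A ((ZMod p → ι) → B) => k w) (t_pow_p p hB A)
  · rw [← Module.End.mul_apply, ← pow_add, e]
    congr 2
    omega

lemma seqK (X : SimplicialObject (FM R)) (j : ℕ) (hj : 1 ≤ j) (hjp : j < p) :
    Seq3 (hl (CC (KF p A h j) X)) (hl (CC (KF p A h (j+1)) X)) (hl (CC (IF p A h hB) X)) := by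
  apply CC_seq (KK p h j) (KI p h hB j hj)
  · intro Y v w hvw
    have := congrArg Subtype.val hvw
    exact Subtype.ext this
  · rintro Y ⟨u, hu⟩
    obtain ⟨w, hw1, hw2⟩ := surjI (A := A) p hB u ((mem_KS1 (A := A) p h).1 hu.1) hu.2 j hjp
    exact ⟨⟨w, hw1⟩, Subtype.ext hw2⟩
  · rintro Y ⟨u, hu⟩
    constructor
    · intro hz
      have : ((tt p Y.ι : Module.End A ((ZMod p → Y.ι) → B)) ^ j) u = 0 := congrArg Subtype.val hz
      exact ⟨⟨u, this⟩, Subtype.ext rfl⟩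
    · rintro ⟨⟨v, hv⟩, hvu⟩
      have : v = u := congrArg Subtype.val hvu
      subst this
      exact Subtype.ext hv

/-- I -> K_1 -/
def IK : IF p A h hB ⟶ KF p A h 1 := subM (𝟙 _) fun X v hv => hv.1

variable [CharP B p]

/-- K_1 -> Frobenius twist -/
def KP : KF p A h 1 ⟶ E A ((frobenius B p).comp h) B where
  app X := ModuleCat.ofHom
    { toFun := fun v => fun i => (v.1 : (ZMod p → X.ι) → B) (fun _ => i)
      map_add' := fun _ _ => rfl
      map_smul' := fun _ _ => rfl }
  naturality X Y f := by
    refine ModuleCat.hom_ext (LinearMap.ext fun v => funext fun i => ?_)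
    exact act_const (A := A) p h (CharP.cast_eq_zero B p) f v.1 ((mem_KS1 (A := A) p h).1 v.2) i

lemma seqI (X : SimplicialObject (FM R)) :
    Seq3 (hl (CC (IF p A h hB) X)) (hl (CC (KF p A h 1) X))
      (hl (CC (E A ((frobenius B p).comp h) B) X)) := by
  classical
  apply CC_seq (IK p h hB) (KP p h)
  · intro Y v w hvw
    have := congrArg Subtype.val hvw
    exact Subtype.ext this
  · intro Y (g : Y.ι → B)
    refine ⟨⟨fun a => if ∃ i, a = fun _ => i then g (a 0) else 0, ?_⟩, ?_⟩
    · refine (mem_KS1 (A := A) p h).2 fun a => ?_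
      have key : (∃ i, shc p 1 a = fun _ => i) ↔ ∃ i, a = fun _ => i := by
        refine exists_congr fun i => ?_
        constructor
        · intro h
          have := congrArg (shc p (-1)) h
          rw [shc_shc] at this
          simpa using this
        · rintro rfl; rfl
      by_cases h1 : ∃ i, a = fun _ => i
      · obtain ⟨i, rfl⟩ := h1
        rfl
      · exact (if_neg (fun h2 => h1 (key.1 h2))).trans (if_neg h1).symm
    · funext i
      exact if_pos ⟨i, rfl⟩
  · rintro Y ⟨u, hu⟩
    constructor
    · intro hz
      exact ⟨⟨u, ⟨hu, fun i => congrFun hz i⟩⟩, Subtype.ext rfl⟩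
    · rintro ⟨⟨v, hv⟩, hvu⟩
      have : v = u := congrArg Subtype.val hvu
      subst this
      exact funext hv.2

/-- P -> K_1 -/
noncomputable def PK : PF p R ⋙ E A h B ⟶ KF p A h 1 where
  app X := ModuleCat.ofHom
    { toFun := fun v => ⟨fun a => (v : Orb p X.ι → B) (omk p a),
        (mem_KS1 (A := A) p h).2 fun a => by rw [omk_shc]⟩
      map_add' := fun _ _ => rfl
      map_smul' := fun _ _ => rfl }
  naturality X Y f := by
    refine ModuleCat.hom_ext (LinearMap.ext fun (v : Orb p X.ι → B) =>
      Subtype.ext (funext fun (a : ZMod p → Y.ι) => ?_))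
    change ∑ o, h (Pm p (Tm p (mat f)) (omk p a) o) • (v : Orb p X.ι → B) o =
      ∑ b, h (Tm p (mat f) a b) • (v : Orb p X.ι → B) (omk p b)
    rw [sum_orb p]
    refine Finset.sum_congr rfl fun o _ => ?_
    rw [Pm_mk p (Tm_inv p (mat f)), map_sum, Finset.sum_smul]
    refine Finset.sum_congr rfl fun b _ => ?_
    split_ifs with hb
    · rw [hb]
    · simp

lemma hlP (X : SimplicialObject (FM R)) :
    hl (CC (PF p R ⋙ E A h B) X) = hl (CC (KF p A h 1) X) := by
  apply CC_bij (PK p h)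
  intro Y
  constructor
  · intro v w hvw
    refine funext fun (o : Orb p Y.ι) => ?_
    have := congrFun (congrArg Subtype.val hvw) (oout p o)
    change (v : Orb p Y.ι → B) (omk p (oout p o)) = (w : Orb p Y.ι → B) (omk p (oout p o)) at this
    rw [omk_oout] at this
    exact this
  · rintro ⟨u, hu⟩
    have hu1 := (mem_KS1 (A := A) p h).1 hu
    have hu' : ∀ (c : ZMod p) a, (u : (ZMod p → Y.ι) → B) (shc p c a) = u a := by
      intro c a
      rw [← ZMod.natCast_zmod_val c]
      induction c.val with
      | zero => simp
      | succ m ih =>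
        rw [← ih, ← hu1 (shc p m a), shc_shc]
        congr 2
        push_cast
        ring
    refine ⟨fun o => u (oout p o), Subtype.ext (funext fun (a : ZMod p → Y.ι) => ?_)⟩
    change (u : (ZMod p → Y.ι) → B) (oout p (omk p a)) = u a
    obtain ⟨c, hc⟩ := (omk_eq p).1 (omk_oout p (omk p a)).symm
    rw [hc, hu']

lemma hlV (X : SimplicialObject (FM R)) :
    hl (CC (KF p A h p) X) = hl (CC (TF p R ⋙ E A h B) X) := by
  apply CC_bij (Φ := KF p A h p) (Ψ := TF p R ⋙ E A h B)
    { app := fun X => ModuleCat.ofHom (KS p h p X).subtype, naturality := fun X Y f => rfl }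
  intro Y
  constructor
  · exact Subtype.val_injective
  · intro v
    refine ⟨⟨v, ?_⟩, rfl⟩
    exact congrArg (fun k : Module.End A ((ZMod p → Y.ι) → B) => k v)
      (t_pow_p p (CharP.cast_eq_zero B p) A)

theorem jordan_step (X : SimplicialObject (FM R))
    (fT : FS (hl (CC (TF p R ⋙ E A h B) X))) (cT : chi (hl (CC (TF p R ⋙ E A h B) X)) = 0)
    (fP : FS (hl (CC (PF p R ⋙ E A h B) X))) (cP : chi (hl (CC (PF p R ⋙ E A h B) X)) = 0)
    (fE : FS (hl (CC (E A ((frobenius B p).comp h) B) X))) :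
    chi (hl (CC (E A ((frobenius B p).comp h) B) X)) = 0 := by
  have hB : (p : B) = 0 := CharP.cast_eq_zero B p
  rw [hlP] at fP cP
  rw [← hlV] at fT cT
  have fI := (seqI (A := A) p h hB X).fs1 fP fE
  have e1 := (seqI (A := A) p h hB X).chi_add fI fP fE
  have key : ∀ j, 1 ≤ j → j ≤ p → FS (hl (CC (KF p A h j) X)) ∧
      chi (hl (CC (KF p A h j) X)) = (j - 1 : ℤ) * chi (hl (CC (IF p A h hB) X)) := by
    intro j hj
    induction j, hj using Nat.le_induction with
    | base => intro _; exact ⟨fP, by simp [cP]⟩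
    | succ j hj ih =>
      intro hjp
      obtain ⟨f1, c1⟩ := ih (by omega)
      have s := seqK (A := A) p h hB X j hj (by omega)
      have f2 := s.fs2 f1 fI
      refine ⟨f2, ?_⟩
      rw [s.chi_add f1 f2 fI, c1]
      push_cast
      ring
  have := (key p (Fact.out : p.Prime).one_le le_rfl).2
  rw [cT] at this
  have h2 : (p - 1 : ℤ) ≠ 0 := by
    have := (Fact.out : p.Prime).two_le
    omega
  have h3 : chi (hl (CC (IF p A h hB) X)) = 0 := by
    rcases mul_eq_zero.1 this.symm with h | h
    · exact absurd h h2
    · exact h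
  rw [cP, h3, zero_add] at e1
  exact e1.symm

end FM

end

section
open CategoryTheory
open AlgebraicTopology AlgebraicTopology.DoldKan
open scoped Simplicial DoldKan

lemma finlen {A : Type} [CommRing A] [IsNoetherianRing A] [IsLocalRing A] (M : Type)
    [AddCommGroup M] [Module A M] [Module.Finite A M]
    (h : ∀ y ∈ IsLocalRing.maximalIdeal A, ∃ N : ℕ, ∀ z : M, y ^ N • z = 0) :
    Module.length A M ≠ ⊤ := by
  by_cases hI : Module.annihilator A M = ⊤
  · rw [Module.annihilator_eq_top_iff] at hI
    simp
  have hmin : IsLocalRing.maximalIdeal A ∈ (Module.annihilator A M).minimalPrimes := by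
    refine ⟨⟨inferInstance, IsLocalRing.le_maximalIdeal hI⟩, ?_⟩
    rintro q ⟨hq, hle⟩ - y hy
    obtain ⟨N, hN⟩ := h y hy
    exact hq.mem_of_pow_mem N (hle (Module.mem_annihilator.2 hN))
  have := IsLocalRing.quotient_artinian_of_mem_minimalPrimes_of_isLocalRing _ hmin
  letI : Module (A ⧸ Module.annihilator A M) M := Module.quotientAnnihilator
  haveI : IsScalarTower A (A ⧸ Module.annihilator A M) M :=
    Module.IsTorsionBySet.isScalarTower (Module.isTorsionBySet_annihilator A M)
  have e := Module.length_eq_of_surjective (S := A) (R := A ⧸ Module.annihilator A M) (M := M)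
    Ideal.Quotient.mk_surjective
  haveI : Module.Finite (A ⧸ Module.annihilator A M) M := Module.Finite.of_restrictScalars_finite A _ _
  rw [e]
  exact Module.length_ne_top

section
variable {A : Type} [CommRing A]

lemma hm_scalar {C : ChainComplex (ModuleCat.{0} A) ℕ} (φ : C ⟶ C) (i : ℕ) (y : A)
    (h : ∀ v, (φ.f i).hom v = y • v) (z : C.homology i) :
    (HomologicalComplex.homologyMap φ i).hom z = y • z := by
  have hs : Function.Surjective (C.homologyπ i).hom :=
    (ModuleCat.epi_iff_surjective _).1 inferInstance
  obtain ⟨c, rfl⟩ := hs z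
  have e1 := congrArg (fun k => k.hom c) (HomologicalComplex.homologyπ_naturality φ i)
  have e2 := congrArg (fun k => k.hom c) (HomologicalComplex.cyclesMap_i φ i)
  have hi : Function.Injective (C.iCycles i).hom :=
    (ModuleCat.mono_iff_injective _).1 inferInstance
  have e3 : (HomologicalComplex.cyclesMap φ i).hom c = y • c := by
    apply hi
    rw [map_smul]
    exact e2.trans (h _)
  refine e1.trans ?_
  rw [← map_smul, ← e3]
  rfl

lemma homology_fg [IsNoetherianRing A] (C : ChainComplex (ModuleCat.{0} A) ℕ) (i : ℕ)
    [Module.Finite A (C.X i)] : Module.Finite A (C.homology i) := by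
  have hs : Function.Surjective (C.homologyπ i).hom :=
    (ModuleCat.epi_iff_surjective _).1 inferInstance
  have hi : Function.Injective (C.iCycles i).hom :=
    (ModuleCat.mono_iff_injective _).1 inferInstance
  have : Module.Finite A (C.cycles i) := Module.Finite.of_injective _ hi
  exact Module.Finite.of_surjective _ hs

/-- homotopy annihilation -/
lemma kill_of_homotopy {C : ChainComplex (ModuleCat.{0} A) ℕ} {φ ψ : C ⟶ C} (H : Homotopy φ ψ)
    (i : ℕ) (y : A) (h : ∀ v, (φ.f i).hom v = 0) (h' : ∀ v, (ψ.f i).hom v = y • v)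
    (z : C.homology i) : y • z = 0 := by
  rw [← hm_scalar ψ i y h' z, ← H.homologyMap_eq i, hm_scalar φ i 0 (by simpa using h) z, zero_smul]

end

lemma snd_null {C : Type*} [Category C] [Preadditive C] (Y : SimplicialObject C)
    (e : ∀ m : ℕ, Y _⦋m⦌ ⟶ Y _⦋m⦌) (s : ∀ m : ℕ, Y _⦋m⦌ ⟶ Y _⦋m+1⦌)
    (h1 : ∀ m, s m ≫ Y.δ 0 = e m)
    (h2 : ∀ m (i : Fin (m+2)), s (m+1) ≫ Y.δ i.succ = Y.δ i ≫ s m) (h3 : s 0 ≫ Y.δ 1 = 0) :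
    ∃ ψ : K[Y] ⟶ K[Y], (∀ m, ψ.f m = e m) ∧ Nonempty (Homotopy 0 ψ) := by
  have a0 : s 0 ≫ (∑ i : Fin 2, (-1 : ℤ) ^ (i : ℕ) • Y.δ i) = e 0 := by
    rw [Fin.sum_univ_two, Preadditive.comp_add, Preadditive.comp_zsmul, Preadditive.comp_zsmul, h1, h3]
    simp
  have a1 : ∀ m : ℕ, (∑ i : Fin (m+2), (-1 : ℤ) ^ (i : ℕ) • Y.δ i) ≫ s m +
      s (m+1) ≫ (∑ i : Fin (m+3), (-1 : ℤ) ^ (i : ℕ) • Y.δ i) = e (m+1) := by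
    intro m
    rw [Fin.sum_univ_succ (n := m+2), Preadditive.comp_add, Preadditive.comp_sum,
      Preadditive.sum_comp]
    simp only [Preadditive.comp_zsmul, Preadditive.zsmul_comp, h1, h2, Fin.val_succ, pow_succ]
    simp [Finset.sum_neg_distrib]
  let h : ∀ i j, (ComplexShape.down ℕ).Rel j i → (K[Y].X i ⟶ K[Y].X j) :=
    fun i j hij => (s i : K[Y].X i ⟶ K[Y].X (i+1)) ≫ eqToHom (congrArg K[Y].X hij)
  have hh : ∀ i, h i (i+1) (by simp) = (s i : K[Y].X i ⟶ K[Y].X (i+1)) := by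
    intro i
    exact Category.comp_id _
  refine ⟨Homotopy.nullHomotopicMap' h, ?_, ⟨(Homotopy.nullHomotopy' h).symm⟩⟩
  intro m
  cases m with
  | zero =>
    rw [Homotopy.nullHomotopicMap'_f_of_not_rel_left (k₁ := 1) (k₀ := 0) (by simp) (by simp)]
    rw [hh 0, AlternatingFaceMapComplex.obj_d_eq]
    exact a0
  | succ m =>
    rw [Homotopy.nullHomotopicMap'_f (k₂ := m+2) (k₁ := m+1) (k₀ := m) (by simp) (by simp)]
    rw [hh m, hh (m+1), AlternatingFaceMapComplex.obj_d_eq, AlternatingFaceMapComplex.obj_d_eq]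
    exact a1 m

namespace FM
variable {A : Type} [CommRing A] [IsLocalRing A]

/-- strong null-homotopy of multiplication by `y` -/
def SND (X : SimplicialObject (FM A)) (y : A) : Prop :=
  ∃ s : ∀ m : ℕ, X _⦋m⦌ ⟶ X _⦋m+1⦌, (∀ m, s m ≫ X.δ 0 = scal _ y) ∧
    (∀ m (i : Fin (m+2)), s (m+1) ≫ X.δ i.succ = X.δ i ≫ s m) ∧ s 0 ≫ X.δ 1 = 0

/-- The property which is inherited by tensor powers. -/
structure Good (X : SimplicialObject (FM A)) : Prop where
  g1 : ∃ n : ℕ, ∀ m, n < m → (PInfty : K[X] ⟶ K[X]).f m = 0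
  g2 : ∀ y ∈ IsLocalRing.maximalIdeal A, ∃ N : ℕ, SND X (y ^ N)

/-- whiskering -/
abbrev wh (Φ : FM A ⥤ FM A) (X : SimplicialObject (FM A)) : SimplicialObject (FM A) :=
  ((SimplicialObject.whiskering _ _).obj Φ).obj X

lemma g2_wh (p : ℕ) (Φ : FM A ⥤ FM A) (h0 : ∀ X Y : FM A, Φ.map (0 : X ⟶ Y) = 0)
    (h1 : ∀ (X : FM A) y, Φ.map (scal X y) = scal _ (y ^ p)) {X : SimplicialObject (FM A)}
    (hX : Good X) : ∀ y ∈ IsLocalRing.maximalIdeal A, ∃ N : ℕ, SND (wh Φ X) (y ^ N) := by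
  intro y hy
  obtain ⟨N, s, hs1, hs2, hs3⟩ := hX.g2 y hy
  refine ⟨N * p, fun m => Φ.map (s m), fun m => ?_, fun m i => ?_, ?_⟩
  · refine (Φ.map_comp _ _).symm.trans ?_
    refine (congrArg Φ.map (hs1 m)).trans ?_
    rw [h1, ← pow_mul]
    rfl
  · refine (Φ.map_comp _ _).symm.trans (Eq.trans ?_ (Φ.map_comp _ _))
    exact congrArg Φ.map (hs2 m i)
  · refine (Φ.map_comp _ _).symm.trans ?_
    exact (congrArg Φ.map hs3).trans (h0 _ _)

lemma id_decomp (X : SimplicialObject (FM A)) (n : ℕ)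
    (hn : ∀ m, n < m → (PInfty : K[X] ⟶ K[X]).f m = 0) (m : ℕ) (hm : n ≤ m) :
    ∃ (κ : Type) (_ : Fintype κ) (g : κ → (X _⦋m⦌ ⟶ X _⦋n⦌)) (τ : κ → (⦋m⦌ ⟶ ⦋n⦌)),
      𝟙 (X _⦋m⦌) = ∑ k, g k ≫ X.map (τ k).op := by
  induction m, hm using Nat.le_induction with
  | base => exact ⟨Unit, inferInstance, fun _ => 𝟙 _, fun _ => 𝟙 _, by simp⟩
  | succ m hm ih =>
    obtain ⟨κ, _, g, τ, e⟩ := ih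
    have h1 := PInfty_f_add_QInfty_f (X := X) (m + 1)
    rw [hn (m+1) (by omega), zero_add, QInfty_f, decomposition_Q] at h1
    refine ⟨Fin (m+1) × κ, inferInstance, fun k => if k.1.val < m + 1 then
        (P k.1).f (m+1) ≫ X.δ (Fin.rev k.1).succ ≫ g k.2 else 0,
      fun k => SimplexCategory.σ (Fin.rev k.1) ≫ τ k.2, ?_⟩
    refine Eq.trans h1.symm ?_
    rw [Finset.sum_filter, Fintype.sum_prod_type]
    refine Finset.sum_congr rfl fun i _ => ?_
    rw [if_pos i.2]
    simp only [i.2, if_true]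
    conv_lhs => rw [← Category.id_comp (X.σ _), e]
    simp only [Preadditive.sum_comp, Preadditive.comp_sum, Category.assoc, op_comp, X.map_comp]
    rfl

lemma PInfty_zero_of_decomp (Y : SimplicialObject (FM A)) (m : ℕ)
    (N : Fin (m+1) → (Y _⦋m+1⦌ ⟶ Y _⦋m+1⦌)) (e : 𝟙 (Y _⦋m+1⦌) = ∑ v, N v ≫ Y.δ v.castSucc ≫ Y.σ v) :
    (PInfty : K[Y] ⟶ K[Y]).f (m+1) = 0 := by
  have : (PInfty : K[Y] ⟶ K[Y]).f (m+1) = 𝟙 (Y _⦋m+1⦌) ≫ (PInfty : K[Y] ⟶ K[Y]).f (m+1) :=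
    (Category.id_comp _).symm
  rw [this, e, Preadditive.sum_comp]
  exact Finset.sum_eq_zero fun v _ => by simp

end FM

end

section
open CategoryTheory
open AlgebraicTopology AlgebraicTopology.DoldKan
open scoped Simplicial DoldKan

namespace FM
section
variable (p : ℕ) [Fact p.Prime] {R : Type} [CommRing R]

/-- tensor product of a family of matrices -/
def TT {κ ι : Type} (M : ZMod p → Matrix κ ι R) : Matrix (ZMod p → κ) (ZMod p → ι) R :=
  fun a b => ∏ r, M r (a r) (b r)

lemma Tm_mul_TT {κ ι ν : Type} [Fintype ν] [DecidableEq ν] (M : Matrix κ ν R)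
    (N : ZMod p → Matrix ν ι R) : Tm p M * TT p N = TT p (fun r => M * N r) := by
  ext a b
  simp only [Matrix.mul_apply, Tm, TT]
  rw [Finset.prod_univ_sum, Fintype.piFinset_univ]
  exact Finset.sum_congr rfl fun c _ => Finset.prod_mul_distrib.symm

lemma sum_TT {κ ι ν : Type} [Fintype ν] [DecidableEq ν] (M : ν → Matrix κ ι R) :
    ∑ K : ZMod p → ν, TT p (fun r => M (K r)) = Tm p (∑ k, M k) := by
  ext a b
  simp only [Tm, TT, Matrix.sum_apply]
  rw [Finset.prod_univ_sum, Fintype.piFinset_univ]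

lemma TT_sh {κ ι ν : Type} (M : ν → Matrix κ ι R) (K : ZMod p → ν) (c : ZMod p) (a b) :
    TT p (fun r => M (shc p c K r)) (shc p c a) (shc p c b) = TT p (fun r => M (K r)) a b := by
  simp only [TT, shc]
  exact Equiv.prod_comp (Equiv.addRight c) fun r => M (K r) (a r) (b r)

open Classical in
/-- choice depending on the set only -/
noncomputable def pick {m : ℕ} (s : Set (Fin (m+1))) : Fin (m+1) :=
  if h : s.Nonempty then h.some else 0

lemma pick_mem {m : ℕ} {s : Set (Fin (m+1))} (h : s.Nonempty) : pick s ∈ s := by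
  rw [pick, dif_pos h]; exact h.some_mem

lemma exists_collapse {n m : ℕ} (hm : n * p ≤ m) (τ : ZMod p → (Fin (m+2) → ℕ))
    (h1 : ∀ r, Monotone (τ r)) (h2 : ∀ r j, τ r j ≤ n) :
    ∃ v : Fin (m+1), ∀ r, τ r v.castSucc = τ r v.succ := by
  by_contra hcon
  push Not at hcon
  have hs : ∀ j : Fin (m+2), (j : ℕ) ≤ ∑ r, τ r j := by
    intro j
    induction j using Fin.induction with
    | zero => simp
    | succ v ih =>
      obtain ⟨r, hr⟩ := hcon v
      have hle : ∀ r, τ r v.castSucc ≤ τ r v.succ := fun r => h1 r (Fin.castSucc_lt_succ).le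
      have : ∑ r, τ r v.castSucc < ∑ r, τ r v.succ :=
        Finset.sum_lt_sum (fun r _ => hle r) ⟨r, Finset.mem_univ _, lt_of_le_of_ne (hle r) hr⟩
      simp only [Fin.val_succ, Fin.val_castSucc] at *
      omega
  have h3 := hs (Fin.last _)
  have h4 : ∑ r, τ r (Fin.last _) ≤ ∑ r : ZMod p, n := Finset.sum_le_sum fun r _ => h2 r _
  simp [ZMod.card] at h3 h4
  rw [mul_comm] at h4
  omega

/-- the main decomposition in plain form -/
lemma decomp_plain {ι ν : Type} [Fintype ι] [DecidableEq ι] [Fintype ν] [DecidableEq ν] {m : ℕ}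
    (M : ν → Matrix ι ι R)
    (h1 : ∑ k, M k = 1) (e : Fin (m+1) → Matrix ι ι R) (T : ν → Set (Fin (m+1)))
    (hT : ∀ k, ∀ v ∈ T k, e v * M k = M k)
    (hc : ∀ K : ZMod p → ν, ∃ v, ∀ r, v ∈ T (K r)) :
    ∃ N : Fin (m+1) → Matrix (ZMod p → ι) (ZMod p → ι) R, (∀ v, Inv p (N v)) ∧
      (∀ v, Tm p (e v) * N v = N v) ∧ ∑ v, N v = 1 := by
  classical
  let S : (ZMod p → ν) → Set (Fin (m+1)) := fun K => {v | ∀ r, v ∈ T (K r)}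
  have hS : ∀ c K, S (shc p c K) = S K := by
    intro c K
    ext v
    exact ⟨fun h r => by simpa [shc] using h (r - c), fun h r => h _⟩
  refine ⟨fun v => ∑ K, if pick (S K) = v then TT p (fun r => M (K r)) else 0, ?_, ?_, ?_⟩
  · intro v c a b
    have key : ∀ K, (if pick (S (shc p c K)) = v then TT p (fun r => M (shc p c K r)) else 0) (shc p c a) (shc p c b)
        = (if pick (S K) = v then TT p (fun r => M (K r)) else 0) a b := by
      intro K
      rw [hS]
      split_ifs
      · exact TT_sh p M K c a b
      · rfl
    refine (Matrix.sum_apply _ _ _ _).trans (Eq.trans ?_ (Matrix.sum_apply _ _ _ _).symm)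
    refine Eq.trans (Equiv.sum_comp (shE p c) _).symm ?_
    exact Finset.sum_congr rfl fun K _ => key K
  · intro v
    rw [Finset.mul_sum]
    refine Finset.sum_congr rfl fun K _ => ?_
    split_ifs with h
    · rw [Tm_mul_TT]
      congr 1
      funext r
      have h5 : pick (S K) ∈ S K := pick_mem (hc K)
      exact hT _ _ (h ▸ h5 r)
    · simp
  · rw [Finset.sum_comm]
    simp only [Finset.sum_ite_eq, Finset.mem_univ, if_true]
    rw [sum_TT, h1, Tm_one]
end

variable {A : Type} [CommRing A] [IsLocalRing A] (p : ℕ) [Fact p.Prime]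

lemma g1_decomp (X : SimplicialObject (FM A)) (n : ℕ)
    (hn : ∀ m, n < m → (PInfty : K[X] ⟶ K[X]).f m = 0) (m : ℕ) (hm : n * p ≤ m) :
    ∃ N : Fin (m+1) → Matrix (ZMod p → (X _⦋m+1⦌).ι) (ZMod p → (X _⦋m+1⦌).ι) A, (∀ v, Inv p (N v)) ∧
      (∀ v, Tm p (mat (X.δ v.castSucc ≫ X.σ v)) * N v = N v) ∧ ∑ v, N v = 1 := by
  classical
  have hp := (Fact.out : p.Prime).pos
  obtain ⟨κ, _, g, τ, e⟩ := id_decomp X n hn (m+1) (by nlinarith)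
  refine decomp_plain p (fun k => mat (g k ≫ X.map (τ k).op)) ?_ _
    (fun k => {v | τ k v.castSucc = τ k v.succ}) ?_ ?_
  · rw [← mat_sum, ← e, mat_id]
  · intro k v hv
    rw [← mat_comp]
    congr 1
    obtain ⟨θ', h⟩ := SimplexCategory.eq_σ_comp_of_not_injective' (τ k) v hv
    rw [h]
    have h2 : X.map (SimplexCategory.σ v ≫ θ').op = X.map θ'.op ≫ X.σ v := by
      rw [op_comp, X.map_comp]; rfl
    rw [h2]
    have := X.δ_comp_σ_self (i := v)
    simp only [Category.assoc]
    rw [reassoc_of% this]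
  · intro K
    obtain ⟨v, hv⟩ := exists_collapse p hm (fun r j => ((τ (K r) j : Fin (n+1)) : ℕ))
      (fun r a b hab => (τ (K r)).toOrderHom.monotone hab)
      (fun r j => Nat.le_of_lt_succ (τ (K r) j : Fin (n+1)).2)
    exact ⟨v, fun r => Fin.ext (hv r)⟩

lemma Good.TF {X : SimplicialObject (FM A)} (hX : Good X) : Good (wh (TF p A) X) := by
  refine ⟨?_, g2_wh p (FM.TF p A) (fun _ _ => mat_inj (Tm_zero p)) (fun X y => mat_inj (Tm_smul_one p y)) hX⟩
  obtain ⟨n, hn⟩ := hX.g1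
  refine ⟨n * p, fun m hm => ?_⟩
  obtain ⟨m, rfl⟩ : ∃ j, m = j + 1 := ⟨m - 1, by omega⟩
  obtain ⟨N, h1, h2, h3⟩ := g1_decomp p X n hn m (by omega)
  refine PInfty_zero_of_decomp _ m (fun v => hom (N v)) ?_
  apply mat_inj
  rw [mat_sum]
  refine Eq.trans h3.symm (Finset.sum_congr rfl fun v _ => ?_)
  refine (h2 v).symm.trans ?_
  have : (FM.TF p A).map (X.δ v.castSucc ≫ X.σ v) = (wh (FM.TF p A) X).δ v.castSucc ≫ (wh (FM.TF p A) X).σ v :=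
    Functor.map_comp _ _ _
  rw [mat_comp, ← this]
  rfl

lemma Good.PF {X : SimplicialObject (FM A)} (hX : Good X) : Good (wh (PF p A) X) := by
  refine ⟨?_, g2_wh p (FM.PF p A) (fun _ _ => mat_inj ?_) (fun X y => mat_inj ?_) hX⟩
  rotate_left
  · show Pm p (Tm p 0) = 0
    rw [Tm_zero, Pm_zero]
    rfl
  · show Pm p (Tm p (y • 1)) = (y ^ p) • 1
    rw [Tm_smul_one, Pm_smul_one]
    rfl
  obtain ⟨n, hn⟩ := hX.g1
  refine ⟨n * p, fun m hm => ?_⟩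
  obtain ⟨m, rfl⟩ : ∃ j, m = j + 1 := ⟨m - 1, by omega⟩
  obtain ⟨N, h1, h2, h3⟩ := g1_decomp p X n hn m (by omega)
  refine PInfty_zero_of_decomp _ m (fun v => hom (Pm p (N v))) ?_
  apply mat_inj
  rw [mat_sum]
  have h4 : (1 : Matrix (Orb p (X _⦋m+1⦌).ι) (Orb p (X _⦋m+1⦌).ι) A) = ∑ v, Pm p (N v) := by
    rw [← Pm_sum, h3, Pm_one]
  refine Eq.trans h4 (Finset.sum_congr rfl fun v _ => ?_)
  have h5 : Pm p (N v) = Pm p (Tm p (mat (X.δ v.castSucc ≫ X.σ v))) * Pm p (N v) := by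
    rw [← Pm_mul p (h1 v), h2 v]
  refine h5.trans ?_
  have : (FM.PF p A).map (X.δ v.castSucc ≫ X.σ v) = (wh (FM.PF p A) X).δ v.castSucc ≫ (wh (FM.PF p A) X).σ v :=
    Functor.map_comp _ _ _
  rw [mat_comp, ← this]
  rfl
end FM

end

section
open CategoryTheory
open AlgebraicTopology AlgebraicTopology.DoldKan
open scoped Simplicial DoldKan

namespace FM
variable {A : Type} [CommRing A] [IsLocalRing A] [IsNoetherianRing A] {B : Type} [CommRing B]
  [Algebra A B] [Module.Finite A B]

lemma Good.fs {X : SimplicialObject (FM A)} (hX : Good X) (h : A →+* B) (q : ℕ)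
    (hq : ∀ y, h y = algebraMap A B (y ^ q)) : FS (hl (CC (E A h B) X)) := by
  refine ⟨fun i => ?_, ?_⟩
  · haveI : Module.Finite A ((CC (E A h B) X).X i) :=
      inferInstanceAs (Module.Finite A ((X _⦋i⦌).ι → B))
    haveI := homology_fg (CC (E A h B) X) i
    refine finlen _ fun y hy => ?_
    obtain ⟨N, s, h1, h2, h3⟩ := hX.g2 y hy
    obtain ⟨ψ, hψ, ⟨H⟩⟩ := snd_null (((SimplicialObject.whiskering _ _).obj (E A h B)).obj X)
      (fun m => (E A h B).map (scal _ (y ^ N))) (fun m => (E A h B).map (s m))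
      (fun m => ((E A h B).map_comp _ _).symm.trans (congrArg _ (h1 m)))
      (fun m i => ((E A h B).map_comp _ _).symm.trans ((congrArg _ (h2 m i)).trans
        ((E A h B).map_comp _ _)))
      (((E A h B).map_comp _ _).symm.trans ((congrArg _ h3).trans (Functor.map_zero _ _ _)))
    refine ⟨N * q, fun z => ?_⟩
    refine kill_of_homotopy H i _ ?_ ?_ z
    · intro v
      rfl
    · intro (v : (X _⦋i⦌).ι → B)
      refine (congrArg (fun k => k.hom v) (hψ i)).trans ?_
      funext (j : (X _⦋i⦌).ι)
      show ∑ l, h ((y ^ N • (1 : Matrix (X _⦋i⦌).ι (X _⦋i⦌).ι A)) j l) • v l = y ^ (N * q) • v j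
      rw [Finset.sum_eq_single j]
      · simp [hq, ← pow_mul, Algebra.smul_def]
      · intro l _ hl
        simp [Matrix.one_apply_ne hl.symm]
      · simp
  · obtain ⟨n, hn⟩ := hX.g1
    refine ⟨n+1, fun m hm => ?_⟩
    have : Subsingleton ((CC (E A h B) X).homology m) := by
      refine subsingleton_of_forall_eq 0 fun z => ?_
      rw [← one_smul A z]
      refine kill_of_homotopy (homotopyPInftyToId (((SimplicialObject.whiskering _ _).obj (E A h B)).obj X)) m 1 ?_ ?_ z
      · intro v
        rw [map_PInfty_f, hn m (by omega), Functor.map_zero]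
        rfl
      · intro v
        simp
    exact Module.length_eq_zero

lemma chi_base {x : A} [IsDomain A] (hx : x ≠ 0) (hs : Function.Surjective (algebraMap A B))
    (hk : RingHom.ker (algebraMap A B) = Ideal.span {x}) {X : SimplicialObject (FM A)} (hX : Good X) :
    chi (hl (CC (E A (algebraMap A B) B) X)) = 0 := by
  have f1 := hX.fs (B := A) (RingHom.id A) 1 (by simp)
  have f2 := hX.fs (B := B) (algebraMap A B) 1 (by simp)
  let η : E A (RingHom.id A) A ⟶ E A (RingHom.id A) A :=
    { app := fun X => ModuleCat.ofHom (LinearMap.lsmul A (X.ι → A) x)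
      naturality := fun X Y f => by
        refine ModuleCat.hom_ext (LinearMap.ext fun (v : X.ι → A) => ?_)
        exact ((act A (RingHom.id A) A (mat f)).map_smul x v).symm }
  let θ : E A (RingHom.id A) A ⟶ E A (algebraMap A B) B :=
    { app := fun X => ModuleCat.ofHom (LinearMap.compLeft (Algebra.linearMap A B) X.ι)
      naturality := fun X Y f => by
        refine ModuleCat.hom_ext (LinearMap.ext fun (v : X.ι → A) => funext fun (i : Y.ι) => ?_)
        show algebraMap A B (∑ j, mat f i j * v j) =
          ∑ j, algebraMap A B (mat f i j) * algebraMap A B (v j)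
        simp }
  have s := CC_seq η θ X ?_ ?_ ?_
  · have := s.chi_add f1 f1 f2
    linarith
  · intro Y (v : Y.ι → A) (w : Y.ι → A) (hvw : x • v = x • w)
    funext i
    exact mul_left_cancel₀ hx (congrFun hvw i)
  · intro Y (v : Y.ι → B)
    choose w hw using fun i => hs (v i)
    exact ⟨w, funext hw⟩
  · intro Y (v : Y.ι → A)
    show (fun i => algebraMap A B (v i)) = (0 : Y.ι → B) ↔ v ∈ Set.range fun w : Y.ι → A => x • w
    constructor
    · intro h
      have : ∀ i, ∃ w, x * w = v i := by
        intro i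
        have h1 : v i ∈ RingHom.ker (algebraMap A B) := congrFun h i
        rw [hk, Ideal.mem_span_singleton'] at h1
        obtain ⟨w, hw⟩ := h1
        exact ⟨w, by rw [mul_comm, hw]⟩
      choose w hw using this
      exact ⟨w, funext hw⟩
    · rintro ⟨w, rfl⟩
      funext i
      have : x ∈ RingHom.ker (algebraMap A B) := by rw [hk]; exact Ideal.mem_span_singleton_self x
      rw [RingHom.mem_ker] at this
      show algebraMap A B (x * w i) = 0
      rw [map_mul, this, zero_mul]

variable (A B) in
/-- iterated Frobenius -/
def hF (p : ℕ) [Fact p.Prime] [CharP B p] (f : ℕ) : A →+* B :=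
  Nat.rec (algebraMap A B) (fun _ h => (frobenius B p).comp h) f

lemma hF_apply (p : ℕ) [Fact p.Prime] [CharP B p] (f : ℕ) (y : A) :
    hF A B p f y = algebraMap A B (y ^ p ^ f) := by
  induction f with
  | zero => simp [hF]
  | succ f ih =>
    show (hF A B p f y) ^ p = _
    rw [ih, ← map_pow, ← pow_mul, pow_succ]

lemma CC_comp (Φ : FM A ⥤ FM A) (Ψ : FM A ⥤ ModuleCat.{0} A) (X : SimplicialObject (FM A)) :
    CC (Φ ⋙ Ψ) X = CC Ψ (wh Φ X) := rfl

theorem chi_zero (p : ℕ) [Fact p.Prime] [CharP B p] {x : A} [IsDomain A] (hx : x ≠ 0)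
    (hs : Function.Surjective (algebraMap A B))
    (hk : RingHom.ker (algebraMap A B) = Ideal.span {x}) (f : ℕ) :
    ∀ {X : SimplicialObject (FM A)}, Good X → chi (hl (CC (E A (hF A B p f) B) X)) = 0 := by
  induction f with
  | zero => exact fun hX => chi_base hx hs hk hX
  | succ f ih =>
    intro X hX
    have e1 := CC_comp (TF p A) (E A (hF A B p f) B) X
    have e2 := CC_comp (PF p A) (E A (hF A B p f) B) X
    refine jordan_step p (hF A B p f) X ?_ ?_ ?_ ?_ (hX.fs _ _ (hF_apply p (f+1)))
    · rw [e1]; exact (hX.TF p).fs _ _ (hF_apply p f)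
    · rw [e1]; exact ih (hX.TF p)
    · rw [e2]; exact (hX.PF p).fs _ _ (hF_apply p f)
    · rw [e2]; exact ih (hX.PF p)
end FM

end

section
open CategoryTheory
open AlgebraicTopology AlgebraicTopology.DoldKan
open scoped Simplicial DoldKan

namespace FM
section
variable {R : Type} [CommRing R]

/-- the projection matrix -/
def bp {n : ℕ} (ι : Fin n → Type) [∀ j, DecidableEq (ι j)] (j : Fin n) : Matrix (ι j) (Σ j, ι j) R :=
  fun i x => if x = ⟨j, i⟩ then 1 else 0
/-- the inclusion matrix -/
def bi {n : ℕ} (ι : Fin n → Type) [∀ j, DecidableEq (ι j)] (j : Fin n) : Matrix (Σ j, ι j) (ι j) R :=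
  fun x i => if x = ⟨j, i⟩ then 1 else 0

lemma bp_bi {n : ℕ} (ι : Fin n → Type) [∀ j, DecidableEq (ι j)] [∀ j, Fintype (ι j)] (j : Fin n) :
    (bp (R := R) ι j) * (bi (R := R) ι j) = 1 := by
  ext i' i
  rw [Matrix.mul_apply]
  simp only [bp, bi, mul_ite, mul_one, mul_zero]
  rw [Finset.sum_eq_single (⟨j, i⟩ : Σ j, ι j)]
  · simp [Matrix.one_apply, eq_comm]
  · intro b _ hb; simp [hb]
  · simp

lemma bp_bi' {n : ℕ} (ι : Fin n → Type) [∀ j, DecidableEq (ι j)] [∀ j, Fintype (ι j)] (j j' : Fin n)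
    (h : j ≠ j') : (bp (R := R) ι j') * (bi (R := R) ι j) = 0 := by
  ext i' i
  rw [Matrix.mul_apply]
  refine Finset.sum_eq_zero fun x _ => ?_
  simp only [bp, bi]
  by_cases h1 : x = ⟨j', i'⟩
  · subst h1
    rw [if_neg (c := (⟨j', i'⟩ : Σ j, ι j) = ⟨j, i⟩), mul_zero]
    intro h'
    exact h (congrArg Sigma.fst h').symm
  · rw [if_neg h1, zero_mul]

lemma bi_bp {n : ℕ} (ι : Fin n → Type) [∀ j, DecidableEq (ι j)] [∀ j, Fintype (ι j)] :
    ∑ j, (bi (R := R) ι j) * (bp (R := R) ι j) = (1 : Matrix (Σ j, ι j) (Σ j, ι j) R) := by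
  ext x y
  rw [Matrix.sum_apply]
  simp only [Matrix.mul_apply]
  rw [← Fintype.sum_sigma' (fun (j : Fin n) (i : ι j) => (bi (R := R) ι j) x i * (bp (R := R) ι j) i y)]
  refine Eq.trans (b := ∑ z : Σ j, ι j, (if x = z then 1 else 0) * (if y = z then (1 : R) else 0)) rfl ?_
  simp [Matrix.one_apply, eq_comm]

/-- direct sums -/
def bic {n : ℕ} (f : Fin n → FM R) : Limits.Bicone f where
  pt := ⟨Σ j, (f j).ι⟩
  π j := hom (bp (fun j => (f j).ι) j)
  ι j := hom (bi (fun j => (f j).ι) j)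
  ι_π j j' := by
    apply mat_inj
    by_cases h : j = j'
    · subst h
      rw [dif_pos rfl]
      exact bp_bi (fun j => (f j).ι) j
    · rw [dif_neg h]
      exact bp_bi' (fun j => (f j).ι) j j' h

instance : Limits.HasFiniteBiproducts (FM R) where
  out n := ⟨fun f => Limits.hasBiproduct_of_total (bic f) (by
    apply mat_inj
    rw [mat_sum, mat_id]
    exact bi_bp (fun j => (f j).ι))⟩

end
end FM

section star
open SimplexCategory

/-- adding an initial vertex -/
def stf {a b : ℕ} (f : Fin (a+1) →o Fin (b+1)) : Fin (a+1+1) →o Fin (b+1+1) where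
  toFun := Fin.cases 0 (fun i => (f i).succ)
  monotone' := by
    intro i j h
    induction i using Fin.cases with
    | zero => simp
    | succ i =>
      induction j using Fin.cases with
      | zero => simp at h
      | succ j => simpa using f.monotone (by simpa using h)

/-- adding an initial vertex -/
def st {a b : ℕ} (f : ⦋a⦌ ⟶ ⦋b⦌) : ⦋a+1⦌ ⟶ ⦋b+1⦌ :=
  SimplexCategory.Hom.mk (stf f.toOrderHom)

lemma st_zero {a b : ℕ} (f : ⦋a⦌ ⟶ ⦋b⦌) : (st f).toOrderHom (0 : Fin (a+1+1)) = (0 : Fin (b+1+1)) := rfl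
lemma st_succ {a b : ℕ} (f : ⦋a⦌ ⟶ ⦋b⦌) (i : Fin (a + 1)) :
    (st f).toOrderHom (Fin.succ i : Fin (a+1+1)) = Fin.succ (f.toOrderHom i) := rfl

lemma st_comp {a b c : ℕ} (f : ⦋a⦌ ⟶ ⦋b⦌) (g : ⦋b⦌ ⟶ ⦋c⦌) : st (f ≫ g) = st f ≫ st g := by
  apply SimplexCategory.Hom.ext
  apply OrderHom.ext
  funext (i : Fin (a+1+1))
  induction i using Fin.cases with
  | zero => rfl
  | succ i => rfl

lemma st_id (a : ℕ) : st (𝟙 ⦋a⦌) = 𝟙 _ := by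
  apply SimplexCategory.Hom.ext
  apply OrderHom.ext
  funext (i : Fin (a+1+1))
  induction i using Fin.cases with
  | zero => rfl
  | succ i => rfl

lemma δ_st {a b : ℕ} (f : ⦋a⦌ ⟶ ⦋b⦌) :
    SimplexCategory.δ (0 : Fin (a + 2)) ≫ st f = f ≫ SimplexCategory.δ (0 : Fin (b + 2)) := by
  apply SimplexCategory.Hom.ext
  apply OrderHom.ext
  funext i
  rfl

lemma st_δ {m : ℕ} (i : Fin (m+2)) : st (SimplexCategory.δ i) = SimplexCategory.δ i.succ := by
  apply SimplexCategory.Hom.ext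
  apply OrderHom.ext
  funext j
  induction j using Fin.cases with
  | zero => exact (Fin.succ_succAbove_zero i).symm
  | succ j => exact (Fin.succ_succAbove_succ i j).symm

instance st_mono {a b : ℕ} (f : ⦋a⦌ ⟶ ⦋b⦌) [Mono f] : Mono (st f) := by
  rw [SimplexCategory.mono_iff_injective]
  have h := (SimplexCategory.mono_iff_injective (f := f)).1 inferInstance
  intro (i : Fin (a + 1 + 1)) (j : Fin (a + 1 + 1)) hij
  induction i using Fin.cases with
  | zero =>
    induction j using Fin.cases with
    | zero => rfl
    | succ j => exact absurd hij (Fin.succ_ne_zero _).symm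
  | succ i =>
    induction j using Fin.cases with
    | zero => exact absurd hij (Fin.succ_ne_zero _)
    | succ j => exact congrArg Fin.succ (h (Fin.succ_injective _ hij))
end star

end

section
open CategoryTheory
open AlgebraicTopology AlgebraicTopology.DoldKan
open scoped Simplicial DoldKan

section gam
open Opposite
variable {C : Type*} [Category C] [Preadditive C] [Limits.HasFiniteCoproducts C]
  (K : ChainComplex C ℕ)

/-- the simplicial object -/
noncomputable abbrev GX : SimplicialObject C := Γ₀.obj K

/-- inclusion of nondegenerate part -/
noncomputable def GJ (n : ℕ) : K.X n ⟶ (GX K).obj (op ⦋n⦌) := (Γ₀.splitting K).ι n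

lemma GJ_mono {a b : ℕ} (i : ⦋a⦌ ⟶ ⦋b⦌) [Mono i] :
    GJ K b ≫ (GX K).map i.op = Γ₀.Obj.Termwise.mapMono K i ≫ GJ K a := by
  have := Γ₀.Obj.mapMono_on_summand_id K i
  rw [SimplicialObject.Splitting.cofan_inj_id, SimplicialObject.Splitting.cofan_inj_id] at this
  exact this

lemma GJ_zero {a b : ℕ} (θ : ⦋a⦌ ⟶ ⦋b⦌) (h0 : θ.toOrderHom 0 = 0) (hs : ¬ Epi θ) :
    GJ K b ≫ (GX K).map θ.op = 0 := by
  obtain ⟨c, e, i, he, hi, hf⟩ : ∃ (c : ℕ) (e : ⦋a⦌ ⟶ ⦋c⦌) (i : ⦋c⦌ ⟶ ⦋b⦌), Epi e ∧ Mono i ∧ e ≫ i = θ :=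
    ⟨_, Limits.factorThruImage θ, Limits.image.ι θ, inferInstance, inferInstance, Limits.image.fac θ⟩
  subst hf
  rw [op_comp, Functor.map_comp, ← Category.assoc, GJ_mono, Γ₀.Obj.Termwise.mapMono_eq_zero,
    Limits.zero_comp, Limits.zero_comp]
  · intro h
    obtain rfl : b = c := congrArg SimplexCategory.len h
    rw [SimplexCategory.eq_id_of_mono i, Category.comp_id] at hs
    exact hs he
  · rintro ⟨-, h2⟩
    apply h2
    have h3 : e.toOrderHom 0 = 0 := by
      obtain ⟨x, hx⟩ := (SimplexCategory.epi_iff_surjective.1 he) 0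
      exact le_antisymm ((e.toOrderHom.monotone (Fin.zero_le x)).trans hx.le) (Fin.zero_le _)
    have h4 : i.toOrderHom (e.toOrderHom 0) = 0 := h0
    rw [h3] at h4
    exact h4

variable (y : ∀ Z : C, Z ⟶ Z) (t : ∀ k, K.X k ⟶ K.X (k+1)) (D : ∀ k, K.X k ⟶ K.X k)

/-- the basic map -/
noncomputable def gw (k : ℕ) : K.X k ⟶ (GX K).obj (op ⦋k+1⦌) :=
  t k ≫ GJ K (k+1) + D k ≫ GJ K k ≫ (GX K).map (SimplexCategory.σ (0 : Fin (k+1))).op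

variable (hy : ∀ (Z Z' : C) (f : Z ⟶ Z'), y Z ≫ f = f ≫ y Z')
  (h1 : ∀ k, t k ≫ K.d (k+1) k + D k = y _) (h2 : ∀ k, D (k+1) = K.d (k+1) k ≫ t k) (h3 : D 0 = 0)

lemma st_surj_len {a b : ℕ} (i : ⦋a⦌ ⟶ ⦋b⦌) (h : Epi (st i)) : b ≤ a := by
  have := SimplexCategory.len_le_of_epi (st i)
  simp at this
  exact this

include h2 h3 in
lemma gw_mono {a b : ℕ} (i : ⦋a⦌ ⟶ ⦋b⦌) [Mono i] :
    gw K t D b ≫ (GX K).map (st i).op = Γ₀.Obj.Termwise.mapMono K i ≫ gw K t D a := by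
  by_cases hab : b = a
  · subst hab
    obtain rfl := SimplexCategory.eq_id_of_mono i
    rw [st_id, op_id, CategoryTheory.Functor.map_id, Γ₀.Obj.Termwise.mapMono_id]
    exact (Category.comp_id _).trans (Category.id_comp _).symm
  have hlt : a < b := lt_of_le_of_ne (SimplexCategory.len_le_of_mono i) (Ne.symm hab)
  have hJ : GJ K (b+1) ≫ (GX K).map (st i).op = 0 := by
    apply GJ_zero
    · exact st_zero i
    · intro h
      exact absurd (st_surj_len i h) (by omega)
  have hL : gw K t D b ≫ (GX K).map (st i).op =
      D b ≫ GJ K b ≫ (GX K).map ((st i) ≫ SimplexCategory.σ (0 : Fin (b+1))).op := by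
    rw [gw, Preadditive.add_comp, Category.assoc, hJ, Limits.comp_zero, zero_add, op_comp,
      Functor.map_comp]
    simp only [Category.assoc]
  rw [hL]
  by_cases hd : Isδ₀ i
  · obtain rfl : b = a + 1 := hd.1
    obtain rfl := hd.eq_δ₀
    have e1 : st (SimplexCategory.δ (0 : Fin (a+2))) ≫ SimplexCategory.σ (0 : Fin (a+1+1)) = 𝟙 _ := by
      rw [st_δ]
      exact SimplexCategory.δ_comp_σ_succ (i := (0 : Fin (a+2)))
    rw [Γ₀.Obj.Termwise.mapMono_δ₀, e1, op_id, CategoryTheory.Functor.map_id, gw, Preadditive.comp_add, h2]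
    have e2 : K.d (a+1) a ≫ D a = 0 := by
      cases a with
      | zero => rw [h3, Limits.comp_zero]
      | succ a => rw [h2, ← Category.assoc, K.d_comp_d, Limits.zero_comp]
    rw [← Category.assoc (K.d (a+1) a) (D a), e2, Limits.zero_comp, add_zero, Category.assoc]
    congr 2
    exact Category.comp_id _
  · rw [Γ₀.Obj.Termwise.mapMono_eq_zero _ _ (fun h => hab (congrArg SimplexCategory.len h)) hd,
      Limits.zero_comp, GJ_zero, Limits.comp_zero]
    · rfl
    · intro h
      have hlen : b ≤ a + 1 := SimplexCategory.len_le_of_epi (st i ≫ SimplexCategory.σ (0 : Fin (b+1)))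
      have h0 : i.toOrderHom 0 = 0 := by
        by_contra h0
        exact hd ⟨le_antisymm hlen hlt, h0⟩
      have : Epi i := by
        rw [SimplexCategory.epi_iff_surjective] at h ⊢
        intro e
        obtain ⟨x, hx⟩ := h e
        induction (x : Fin (a+1+1)) using Fin.cases with
        | zero =>
          exact ⟨0, h0.trans hx⟩
        | succ x => exact ⟨x, hx⟩
      exact absurd (SimplexCategory.len_le_of_epi i) (by simpa using hlt)

/-- summand inclusions -/
noncomputable def GI {m c : ℕ} (e : ⦋m⦌ ⟶ ⦋c⦌) : K.X c ⟶ (GX K).obj (op ⦋m⦌) :=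
  GJ K c ≫ (GX K).map e.op

lemma GI_ext {m : ℕ} {Z : C} (f g : (GX K).obj (op ⦋m⦌) ⟶ Z)
    (h : ∀ (c : ℕ) (e : ⦋m⦌ ⟶ ⦋c⦌) [Epi e], GI K e ≫ f = GI K e ≫ g) : f = g := by
  apply (Γ₀.splitting K).hom_ext'
  intro A
  exact h A.1.unop.len A.e

lemma GI_map {m m' c c' : ℕ} (e : ⦋m⦌ ⟶ ⦋c⦌) (θ : ⦋m'⦌ ⟶ ⦋m⦌) (e' : ⦋m'⦌ ⟶ ⦋c'⦌) (j : ⦋c'⦌ ⟶ ⦋c⦌) [Mono j]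
    (h : e' ≫ j = θ ≫ e) :
    GI K e ≫ (GX K).map θ.op = Γ₀.Obj.Termwise.mapMono K j ≫ GI K e' := by
  rw [GI, GI, Category.assoc, ← Functor.map_comp, ← op_comp, ← h, op_comp, Functor.map_comp,
    ← Category.assoc, GJ_mono, Category.assoc]

/-- the homotopy -/
noncomputable def gS (m : ℕ) : (GX K).obj (op ⦋m⦌) ⟶ (GX K).obj (op ⦋m+1⦌) :=
  (Γ₀.splitting K).desc (op ⦋m⦌) (fun A => gw K t D A.1.unop.len ≫
    (GX K).map (st (show ⦋m⦌ ⟶ ⦋A.1.unop.len⦌ from A.e)).op)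

lemma gS_inj {m c : ℕ} (e : ⦋m⦌ ⟶ ⦋c⦌) [Epi e] :
    GI K e ≫ gS K t D m = gw K t D c ≫ (GX K).map (st e).op :=
  (Γ₀.splitting K).ι_desc (op ⦋m⦌) _ (SimplicialObject.Splitting.IndexSet.mk e)

lemma exists_fac {a b : ℕ} (θ : ⦋a⦌ ⟶ ⦋b⦌) :
    ∃ (c : ℕ) (e : ⦋a⦌ ⟶ ⦋c⦌) (i : ⦋c⦌ ⟶ ⦋b⦌), Epi e ∧ Mono i ∧ e ≫ i = θ :=
    ⟨_, Limits.factorThruImage θ, Limits.image.ι θ, inferInstance, inferInstance, Limits.image.fac θ⟩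

include h2 h3 in
lemma gS_nat (m : ℕ) (i : Fin (m+2)) :
    gS K t D (m+1) ≫ (GX K).map (SimplexCategory.δ i.succ).op =
      (GX K).map (SimplexCategory.δ i).op ≫ gS K t D m := by
  apply GI_ext
  intro c e he
  obtain ⟨c', e', j, he', hj, hf⟩ := exists_fac (SimplexCategory.δ i ≫ e)
  rw [← Category.assoc, ← Category.assoc, gS_inj, GI_map K e _ e' j hf, Category.assoc,
    Category.assoc, gS_inj, ← Category.assoc (Γ₀.Obj.Termwise.mapMono K j),
    ← gw_mono K t D h2 h3 j, Category.assoc, ← Functor.map_comp, ← Functor.map_comp,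
    ← st_δ, ← op_comp, ← op_comp, ← st_comp, ← st_comp, hf]

include h1 hy in
lemma gS_zero (m : ℕ) : gS K t D m ≫ (GX K).map (SimplexCategory.δ (0 : Fin (m+2))).op = y _ := by
  apply GI_ext
  intro c e he
  have e0 : ∀ k, gw K t D k ≫ (GX K).map (SimplexCategory.δ (0 : Fin (k+2))).op = y _ ≫ GJ K k := by
    intro k
    rw [gw, Preadditive.add_comp, Category.assoc, GJ_mono, Γ₀.Obj.Termwise.mapMono_δ₀,
      Category.assoc, Category.assoc, ← Functor.map_comp, ← op_comp]
    have : SimplexCategory.δ (0 : Fin (k+2)) ≫ SimplexCategory.σ (0 : Fin (k+1)) = 𝟙 _ :=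
      SimplexCategory.δ_comp_σ_self (i := (0 : Fin (k+1)))
    rw [this, op_id, CategoryTheory.Functor.map_id, ← h1 k, Preadditive.add_comp, Category.assoc,
      Category.comp_id]
  rw [← Category.assoc, gS_inj, ← hy, Category.assoc, ← Functor.map_comp, ← op_comp, δ_st,
    op_comp, Functor.map_comp, ← Category.assoc, e0, Category.assoc, GI]

include h3 in
lemma gS_one : gS K t D 0 ≫ (GX K).map (SimplexCategory.δ (1 : Fin 2)).op = 0 := by
  apply GI_ext
  intro c e he
  obtain rfl : c = 0 := Nat.le_zero.1 (SimplexCategory.len_le_of_epi e)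
  obtain rfl := SimplexCategory.eq_id_of_epi e
  have e : GJ K 1 ≫ (GX K).map (SimplexCategory.δ (1 : Fin 2)).op = 0 := by
    rw [GJ_mono, Γ₀.Obj.Termwise.mapMono_eq_zero, Limits.zero_comp]
    · intro h
      exact absurd (congrArg SimplexCategory.len h) (by simp)
    · rw [Isδ₀.iff]; simp
  rw [← Category.assoc, gS_inj, st_id, op_id, CategoryTheory.Functor.map_id, Category.comp_id, gw, h3,
    Limits.zero_comp, add_zero, Category.assoc, e, Limits.comp_zero, Limits.comp_zero]

end gam

end

section
open CategoryTheory
open AlgebraicTopology AlgebraicTopology.DoldKan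
open scoped Simplicial DoldKan

namespace FM
section
variable {A B : Type} [CommRing A] [CommRing B] [Algebra A B]

/-- evaluated complex -/
noncomputable def EC (h : A →+* B) (M : Type) [AddCommGroup M] [Module B M] [Module A M]
    [IsScalarTower A B M] (F : ChainComplex (FM A) ℕ) : ChainComplex (ModuleCat.{0} A) ℕ :=
  ((E A h M).mapHomologicalComplex _).obj F

/-- null homotopies of scalars -/
def NHT (F : ChainComplex (FM A) ℕ) (a : A) : Prop :=
  ∃ t : ∀ k, F.X k ⟶ F.X (k+1), t 0 ≫ F.d 1 0 = scal _ a ∧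
    ∀ k, t (k+1) ≫ F.d (k+2) (k+1) + F.d (k+1) k ≫ t k = scal _ a

instance : Limits.HasFiniteCoproducts (FM A) := inferInstance

lemma EC_hl (h : A →+* B) (M : Type) [AddCommGroup M] [Module B M] [Module A M]
    [IsScalarTower A B M] (F : ChainComplex (FM A) ℕ) :
    hl (EC h M F) = hl (CC (E A h M) (GX F)) := by
  let e : HomotopyEquiv K[GX F] F :=
    (Γ₀.splitting F).homotopyEquivNondegComplex.trans (HomotopyEquiv.ofIso (Γ₀NondegComplexIso F))
  have e2 := hl_hequiv ((E A h M).mapHomotopyEquiv e)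
  have e3 := congrArg (fun Φ => Φ.obj (GX F)) (map_alternatingFaceMapComplex (E A h M))
  refine Eq.trans e2.symm ?_
  exact congrArg hl e3

variable [IsLocalRing A]

lemma good_GX (F : ChainComplex (FM A) ℕ) (n : ℕ) (hn : ∀ i, n < i → IsEmpty (F.X i).ι)
    (hF : ∀ y ∈ IsLocalRing.maximalIdeal A, ∃ N : ℕ, NHT F (y ^ N)) : Good (GX F) where
  g1 := by
    refine ⟨n, fun m hm => ?_⟩
    apply GI_ext
    intro c e he
    rw [Limits.comp_zero]
    by_cases hc : m = c
    · subst hc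
      have := hn m hm
      have h0 : GI F e = 0 := by
        apply mat_inj
        ext i j
        exact (this.false j).elim
      rw [h0]
      exact Limits.zero_comp
    · refine SimplicialObject.Splitting.cofan_inj_comp_PInfty_eq_zero (Γ₀.splitting F) (SimplicialObject.Splitting.IndexSet.mk e) ?_
      rw [SimplicialObject.Splitting.IndexSet.eqId_iff_len_eq]
      exact fun h => hc h.symm
  g2 := by
    intro y hy
    obtain ⟨N, t, ht0, ht⟩ := hF y hy
    let D : ∀ k, F.X k ⟶ F.X k := fun k => Nat.rec (motive := fun k => F.X k ⟶ F.X k) 0 (fun k _ => F.d (k+1) k ≫ t k) k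
    have h1 : ∀ k, t k ≫ F.d (k+1) k + D k = scal _ (y ^ N) := by
      intro k
      cases k with
      | zero => show t 0 ≫ F.d 1 0 + 0 = _; rw [add_zero]; exact ht0
      | succ k => exact ht k
    exact ⟨N, gS F t D, gS_zero F (fun Z => scal Z (y ^ N)) t D (fun Z Z' f => scal_comp _ f) h1,
      gS_nat F t D (fun k => rfl) rfl, gS_one F t D rfl⟩

theorem chi_EC [Module.Finite A B] [IsNoetherianRing A] [IsDomain A] (p : ℕ) [Fact p.Prime] [CharP B p] {x : A} (hx : x ≠ 0)
    (hs : Function.Surjective (algebraMap A B))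
    (hk : RingHom.ker (algebraMap A B) = Ideal.span {x}) (f : ℕ)
    (F : ChainComplex (FM A) ℕ) (n : ℕ) (hn : ∀ i, n < i → IsEmpty (F.X i).ι)
    (hF : ∀ y ∈ IsLocalRing.maximalIdeal A, ∃ N : ℕ, NHT F (y ^ N)) :
    chi (hl (EC (FM.hF A B p f) B F)) = 0 := by
  rw [EC_hl]
  exact chi_zero p hx hs hk f (good_GX F n hn hF)
end
end FM

end

section
open CategoryTheory

lemma hl_le {A : Type} [CommRing A] (C : ChainComplex (ModuleCat.{0} A) ℕ) (i : ℕ) :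
    hl C i ≤ Module.length A (C.X i) := by
  have hs : Function.Surjective (C.homologyπ i).hom :=
    (ModuleCat.epi_iff_surjective _).1 inferInstance
  have hi : Function.Injective (C.iCycles i).hom :=
    (ModuleCat.mono_iff_injective _).1 inferInstance
  exact (Module.length_le_of_surjective _ hs).trans (Module.length_le_of_injective _ hi)

namespace FM
section
variable {A B : Type} [CommRing A] [CommRing B] [Algebra A B] (h : A →+* B)
variable {M M' M'' : Type} [AddCommGroup M] [Module B M] [Module A M] [IsScalarTower A B M]
  [AddCommGroup M'] [Module B M'] [Module A M'] [IsScalarTower A B M']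
  [AddCommGroup M''] [Module B M''] [Module A M''] [IsScalarTower A B M'']

/-- functoriality in the module -/
def Eη (φ : M →ₗ[B] M') : E A h M ⟶ E A h M' where
  app X := ModuleCat.ofHom (LinearMap.compLeft (φ.restrictScalars A) X.ι)
  naturality X Y f := by
    refine ModuleCat.hom_ext (LinearMap.ext fun (v : X.ι → M) => funext fun (i : Y.ι) => ?_)
    show φ (∑ j, h (mat f i j) • v j) = ∑ j, h (mat f i j) • φ (v j)
    simp

/-- functoriality in the module -/
noncomputable def ECη (φ : M →ₗ[B] M') (F : ChainComplex (FM A) ℕ) : EC h M F ⟶ EC h M' F :=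
  (NatTrans.mapHomologicalComplex (Eη h φ) _).app F

lemma pi_inj {ι : Type} (φ : M → M') (hφ : Function.Injective φ) :
    Function.Injective (fun (v : ι → M) i => φ (v i)) := fun v w e => funext fun i => hφ (congrFun e i)

lemma pi_surj {ι : Type} (φ : M → M') (hφ : Function.Surjective φ) :
    Function.Surjective (fun (v : ι → M) i => φ (v i)) := fun v => by
  choose w hw using fun i => hφ (v i)
  exact ⟨w, funext hw⟩

lemma pi_ex {ι : Type} (φ : M → M') (ψ : M' → M'') (e : Function.Exact φ ψ) :
    Function.Exact (fun (v : ι → M) i => φ (v i)) (fun (v : ι → M') i => ψ (v i)) := fun v => by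
  constructor
  · intro hv
    choose w hw using fun i => (e (v i)).1 (congrFun hv i)
    exact ⟨w, funext hw⟩
  · rintro ⟨w, rfl⟩
    exact funext fun i => (e _).2 ⟨_, rfl⟩

lemma EC_short (φ : M →ₗ[B] M') (ψ : M' →ₗ[B] M'') (hφ : Function.Injective φ)
    (hψ : Function.Surjective ψ) (e : Function.Exact φ ψ) (F : ChainComplex (FM A) ℕ) :
    ∃ w, (ShortComplex.mk (ECη h φ F) (ECη h ψ F) w).ShortExact :=
  shortExact_mk _ _ (fun i => pi_inj (ι := (F.X i).ι) φ hφ) (fun i => pi_surj (ι := (F.X i).ι) ψ hψ)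
    (fun i => pi_ex (ι := (F.X i).ι) φ ψ e)

lemma EC_sub (φ : M →ₗ[B] M') (ψ : M' →ₗ[B] M'') (hφ : Function.Injective φ)
    (hψ : Function.Surjective ψ) (e : Function.Exact φ ψ) (F : ChainComplex (FM A) ℕ) (i : ℕ) :
    hl (EC h M' F) i ≤ hl (EC h M F) i + hl (EC h M'' F) i := by
  obtain ⟨w, S⟩ := EC_short h φ ψ hφ hψ e F
  obtain ⟨r, s, a, h0, h1, h2, h3⟩ := les' _ S
  have h1 : hl (EC h M F) i = _ := h1 i
  have h2 : hl (EC h M' F) i = _ := h2 i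
  have h3 : hl (EC h M'' F) i = _ := h3 i
  rw [h1, h2, h3]
  exact add_le_add le_add_self le_self_add

/-- scalar chain map -/
def scalC (F : ChainComplex (FM A) ℕ) (a : A) : F ⟶ F where
  f i := scal _ a
  comm' i j _ := scal_comp _ _

lemma NHT.null {F : ChainComplex (FM A) ℕ} {a : A} (hF : NHT F a) : Nonempty (Homotopy (scalC F a) 0) := by
  obtain ⟨t, h0, h1⟩ := hF
  have hR : ∀ k : ℕ, (ComplexShape.down ℕ).Rel (k+1) k := fun k => rfl
  let H : ∀ i j, (ComplexShape.down ℕ).Rel j i → (F.X i ⟶ F.X j) := fun i j hij =>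
    t i ≫ eqToHom (by rw [show i + 1 = j from hij])
  have e : scalC F a = Homotopy.nullHomotopicMap' H := by
    ext i
    cases i with
    | zero =>
      rw [Homotopy.nullHomotopicMap'_f_of_not_rel_left (hR 0) (by intro l; simp)]
      refine h0.symm.trans ?_
      simp [H]
    | succ k =>
      rw [Homotopy.nullHomotopicMap'_f (hR (k+1)) (hR k)]
      refine (h1 k).symm.trans ?_
      simp only [H, eqToHom_refl, Category.comp_id]
      exact add_comm _ _
  rw [e]
  exact ⟨Homotopy.nullHomotopy' H⟩

lemma EC_null {F : ChainComplex (FM A) ℕ} {a : A} (hF : NHT F a) (i : ℕ) :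
    HomologicalComplex.homologyMap (ECη h (LinearMap.lsmul B M (h a)) F) i = 0 := by
  obtain ⟨H⟩ := hF.null
  have e : ECη h (LinearMap.lsmul B M (h a)) F = ((E A h M).mapHomologicalComplex _).map (scalC F a) := by
    ext i : 1
    refine ModuleCat.hom_ext (LinearMap.ext fun (v : (F.X i).ι → M) => funext fun (j : (F.X i).ι) => ?_)
    show h a • v j = ∑ l, h ((a • (1 : Matrix (F.X i).ι (F.X i).ι A)) j l) • v l
    rw [Finset.sum_eq_single j]
    · simp
    · intro l _ hl
      simp [Matrix.one_apply_ne hl.symm]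
    · simp
  refine (congrArg (fun k => HomologicalComplex.homologyMap k i) e).trans ?_
  refine (((E A h M).mapHomotopy H).homologyMap_eq i).trans ?_
  rw [Functor.map_zero]
  exact HomologicalComplex.homologyMap_zero _ _ _

lemma EC_step {F : ChainComplex (FM A) ℕ} {a : A} (hF : NHT F a) (ψ : M →ₗ[B] M'')
    (hφ : Function.Injective (LinearMap.lsmul B M (h a)))
    (hψ : Function.Surjective ψ) (e : Function.Exact (LinearMap.lsmul B M (h a)) ψ) (i : ℕ) :
    hl (EC h M F) i ≤ hl (EC h M'' F) (i+1) := by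
  obtain ⟨w, S⟩ := EC_short h (LinearMap.lsmul B M (h a)) ψ hφ hψ e F
  obtain ⟨r, s, b, h0, h1, h2, h3, h4⟩ := les _ S
  have h1 : hl (EC h M F) i = _ := h1 i
  have h3 : hl (EC h M'' F) (i+1) = _ := h3 (i+1)
  have h4 : r i = 0 := by
    rw [h4 i]
    have := EC_null h (M := M) hF i
    change HomologicalComplex.homologyMap (ShortComplex.mk (ECη h (LinearMap.lsmul B M (h a)) F) (ECη h ψ F) w).f i = 0 at this
    rw [this]
    refine (congrArg (fun P : Submodule A _ => Module.length A P) LinearMap.range_zero).trans ?_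
    exact Module.length_eq_zero
  rw [h1, h3, h4, add_zero]
  exact le_add_self

/-- the submodule `b^t M` -/
def Rg (M : Type) [AddCommGroup M] [Module B M] (b : B) (t : ℕ) : Submodule B M :=
  LinearMap.range (LinearMap.lsmul B M (b ^ t))

lemma mem_Rg {b : B} {t : ℕ} {x : M} : x ∈ Rg M b t ↔ ∃ y, b ^ t • y = x := Iff.rfl

lemma EC_filt (F : ChainComplex (FM A) ℕ) (b : B) (hb : ∀ x : M, b • x = 0 → x = 0) (i t : ℕ) :
    hl (EC h (M ⧸ Rg M b t) F) i ≤ t * hl (EC h (M ⧸ Rg M b 1) F) i := by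
  have hbt : ∀ t : ℕ, ∀ x : M, b ^ t • x = 0 → x = 0 := by
    intro t
    induction t with
    | zero => intro x hx; simpa using hx
    | succ t ih => intro x hx; rw [pow_succ, mul_smul] at hx; exact hb _ (ih _ hx)
  induction t with
  | zero =>
    have : Subsingleton (M ⧸ Rg M b 0) := by
      rw [Submodule.Quotient.subsingleton_iff, eq_top_iff]
      exact fun x _ => ⟨x, by simp⟩
    have h0 : hl (EC h (M ⧸ Rg M b 0) F) i ≤ 0 := by
      refine (hl_le _ _).trans (le_of_eq ?_)
      exact Module.length_eq_zero (R := A) (M := (F.X i).ι → M ⧸ Rg M b 0)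
    exact h0.trans zero_le
  | succ t ih =>
    have key := EC_sub h (M := M ⧸ Rg M b 1) (M' := M ⧸ Rg M b (t+1)) (M'' := M ⧸ Rg M b t)
      (Submodule.mapQ _ _ (LinearMap.lsmul B M (b ^ t)) (by
        rintro _ ⟨y, rfl⟩
        exact ⟨y, by simp [pow_succ, mul_smul, smul_comm (b ^ t) b y]⟩))
      (Submodule.factor (by
        rintro _ ⟨y, rfl⟩
        exact ⟨b • y, by simp [pow_succ, mul_smul]; exact smul_comm b (b ^ t) y⟩)) ?_ ?_ ?_ F i
    · refine key.trans ?_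
      push_cast
      rw [add_mul, one_mul, add_comm]
      exact add_le_add_left ih _
    · rw [injective_iff_map_eq_zero]
      intro x hx
      obtain ⟨x, rfl⟩ := Submodule.mkQ_surjective _ x
      rw [Submodule.mkQ_apply, Submodule.mapQ_apply, Submodule.Quotient.mk_eq_zero] at hx
      obtain ⟨y, hy⟩ := hx
      rw [Submodule.mkQ_apply, Submodule.Quotient.mk_eq_zero]
      refine ⟨y, ?_⟩
      have : b ^ t • (b ^ 1 • y - x) = 0 := by
        simp only [LinearMap.lsmul_apply] at hy
        rw [smul_sub, ← mul_smul, ← pow_add, hy, sub_self]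
      exact sub_eq_zero.1 (hbt _ _ this)
    · exact Submodule.factor_surjective _
    · intro x
      obtain ⟨x, rfl⟩ := Submodule.mkQ_surjective _ x
      constructor
      · intro hx
        have hx : x ∈ Rg M b t := (Submodule.Quotient.mk_eq_zero _).1 hx
        obtain ⟨y, rfl⟩ := hx
        exact ⟨Submodule.Quotient.mk y, rfl⟩
      · rintro ⟨y, hy⟩
        obtain ⟨y, rfl⟩ := Submodule.mkQ_surjective _ y
        rw [← hy]
        exact (Submodule.Quotient.mk_eq_zero (Rg M b t)).2 ⟨y, rfl⟩
end
end FM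

end

section
open CategoryTheory

namespace FM
section
variable {A B : Type} [CommRing A] [CommRing B] [Algebra A B]
  [IsLocalRing A] [IsNoetherianRing A] [IsNoetherianRing B] [Module.Finite A B]
variable (p : ℕ) [Fact p.Prime] [CharP B p]

lemma EC_len (h : A →+* B) (M : Type) [AddCommGroup M] [Module B M] [Module A M]
    [IsScalarTower A B M] (F : ChainComplex (FM A) ℕ) (i : ℕ) :
    hl (EC h M F) i ≤ Fintype.card (F.X i).ι * Module.length A M := by
  refine (hl_le _ _).trans (le_of_eq ?_)
  refine Eq.trans (Module.length_pi_of_fintype A (fun _ : (F.X i).ι => M)) ?_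
  simp

theorem bound (F : ChainComplex (FM A) ℕ) (n : ℕ) (hn : ∀ i, n < i → IsEmpty (F.X i).ι) (l : List A) :
    ∀ (M : Type) [AddCommGroup M] [Module B M] [Module A M] [IsScalarTower A B M] [Module.Finite B M]
      (hc : ∀ I : Ideal A, I.IsPrime → (∀ a ∈ l, a ∈ I) → Module.annihilator A M ≤ I →
        IsLocalRing.maximalIdeal A ≤ I) (hl0 : ∀ a ∈ l, NHT F a),
    ∃ C : ℕ, ∀ f i : ℕ, hl (EC (FM.hF A B p f) M F) i ≤ ((C * (p ^ f) ^ l.length : ℕ) : ℕ∞) ∧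
      (n < i + l.length → ((p ^ f : ℕ) : ℕ∞) * hl (EC (FM.hF A B p f) M F) i ≤ ((C * (p ^ f) ^ l.length : ℕ) : ℕ∞)) := by
  induction l with
  | nil =>
    intro M _ _ _ _ _ hc _
    haveI : Module.Finite A M := Module.Finite.trans B M
    have hfin : Module.length A M ≠ ⊤ := by
      refine finlen M fun y hy => ?_
      have : y ∈ (Module.annihilator A M).radical := by
        rw [Ideal.radical_eq_sInf]
        refine Ideal.mem_sInf.2 ?_
        rintro I ⟨h1, h2⟩
        exact hc I h2 (by simp) h1 hy
      obtain ⟨N, hN⟩ := this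
      exact ⟨N, Module.mem_annihilator.1 hN⟩
    obtain ⟨L, hL⟩ := ENat.ne_top_iff_exists.1 hfin
    refine ⟨∑ i ∈ Finset.range (n+1), Fintype.card (F.X i).ι * L, fun f i => ?_⟩
    have h1 := EC_len (FM.hF A B p f) M F i
    rw [← hL] at h1
    by_cases hi : i < n + 1
    · refine ⟨?_, fun h => by simp at h; omega⟩
      refine h1.trans ?_
      have := Finset.single_le_sum (f := fun i => Fintype.card (F.X i).ι * L) (fun _ _ => Nat.zero_le _) (Finset.mem_range.2 hi)
      simpa using (by exact_mod_cast this)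
    · haveI := hn i (by omega)
      have h2 : hl (EC (FM.hF A B p f) M F) i = 0 := by simpa using h1
      rw [h2]
      simp
  | cons a l ih =>
    intro M _ _ _ _ _ hc hl0
    set b : B := algebraMap A B a with hb
    have hbs : ∀ (s : ℕ) (M : Type) [AddCommGroup M] [Module B M] [Module A M] [IsScalarTower A B M] (x : M), a ^ s • x = b ^ s • x := by
      intro s M _ _ _ _ x
      rw [hb, ← map_pow, algebraMap_smul]
    -- stable kernel
    obtain ⟨s, hs⟩ : ∃ s : ℕ, ∀ x : M, b ^ (s+1) • x = 0 → b ^ s • x = 0 := by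
      let c : ℕ →o Submodule B M := ⟨fun s => LinearMap.ker (LinearMap.lsmul B M (b ^ s)), by
        refine monotone_nat_of_le_succ fun s x hx => ?_
        rw [LinearMap.mem_ker, LinearMap.lsmul_apply] at hx ⊢
        rw [pow_succ', mul_smul, hx, smul_zero]⟩
      obtain ⟨s, hs⟩ := monotone_stabilizes_iff_noetherian.2 (inferInstance : IsNoetherian B M) c
      refine ⟨s, fun x hx => ?_⟩
      have h1 : x ∈ c (s+1) := hx
      rw [← hs (s+1) (by omega)] at h1
      exact h1
    let N : Submodule B M := LinearMap.ker (LinearMap.lsmul B M (b ^ s))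
    have hN : ∀ x, x ∈ N ↔ b ^ s • x = 0 := fun x => Iff.rfl
    have hreg : ∀ x : M ⧸ N, b • x = 0 → x = 0 := by
      intro x hx
      obtain ⟨x, rfl⟩ := Submodule.mkQ_surjective _ x
      rw [← map_smul, Submodule.mkQ_apply, Submodule.Quotient.mk_eq_zero, hN, ← mul_smul, ← pow_succ] at hx
      rw [Submodule.mkQ_apply, Submodule.Quotient.mk_eq_zero, hN]
      exact hs x hx
    have hregt : ∀ t : ℕ, ∀ x : M ⧸ N, b ^ t • x = 0 → x = 0 := by
      intro t
      induction t with
      | zero => intro x hx; simpa using hx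
      | succ t ih => intro x hx; rw [pow_succ, mul_smul] at hx; exact hreg _ (ih _ hx)
    obtain ⟨C1, hC1⟩ := ih N (by
      intro I hI h1 h2
      have h3 : Module.annihilator A M ≤ Module.annihilator A N := by
        intro y hy
        rw [Module.mem_annihilator] at hy ⊢
        intro x
        exact Subtype.ext (hy x)
      refine hc I hI ?_ (h3.trans h2)
      simp only [List.mem_cons, forall_eq_or_imp]
      refine ⟨?_, h1⟩
      refine hI.mem_of_pow_mem s (h2 ?_)
      rw [Module.mem_annihilator]
      intro x
      rw [hbs]
      exact Subtype.ext x.2) (fun c hc => hl0 c (by simp [hc]))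
    obtain ⟨C2, hC2⟩ := ih ((M ⧸ N) ⧸ Rg (M ⧸ N) b 1) (by
      intro I hI h1 h2
      have h3 : Module.annihilator A M ≤ Module.annihilator A ((M ⧸ N) ⧸ Rg (M ⧸ N) b 1) := by
        intro y hy
        rw [Module.mem_annihilator] at hy ⊢
        intro x
        obtain ⟨x, rfl⟩ := Submodule.mkQ_surjective _ x
        obtain ⟨x, rfl⟩ := Submodule.mkQ_surjective _ x
        have e : Submodule.mkQ (Rg (M ⧸ N) b 1) (Submodule.mkQ N (y • x)) = 0 := by
          rw [hy x, map_zero, map_zero]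
        exact e
      refine hc I hI ?_ (h3.trans h2)
      simp only [List.mem_cons, forall_eq_or_imp]
      refine ⟨?_, h1⟩
      refine h2 ?_
      rw [Module.mem_annihilator]
      intro x
      obtain ⟨x, rfl⟩ := Submodule.mkQ_surjective _ x
      have e : Submodule.mkQ (Rg (M ⧸ N) b 1) (b • x) = 0 := by
        rw [Submodule.mkQ_apply, Submodule.Quotient.mk_eq_zero]
        exact ⟨x, by simp⟩
      rw [← pow_one a, hbs, pow_one]
      exact e) (fun c hc => hl0 c (by simp [hc]))
    refine ⟨C1 + C2, fun f i => ?_⟩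
    set q := p ^ f with hq
    set h := FM.hF A B p f with hh
    have hha : h a = b ^ q := by rw [hh, hF_apply, map_pow]
    have e0 := EC_sub h N.subtype N.mkQ N.injective_subtype N.mkQ_surjective
      (LinearMap.exact_subtype_mkQ N) F i
    have e1 : hl (EC h (M ⧸ N) F) i ≤ hl (EC h ((M ⧸ N) ⧸ Rg (M ⧸ N) b q) F) (i+1) := by
      refine EC_step h (hl0 a (by simp)) (Rg (M ⧸ N) b q).mkQ ?_ (Submodule.mkQ_surjective _) ?_ i
      · rw [hha, injective_iff_map_eq_zero]
        exact fun x hx => hregt q x hx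
      · rw [hha]
        exact LinearMap.exact_map_mkQ_range _
    have e2 := EC_filt h F b hreg (i+1) q
    have e3 := e0.trans (add_le_add_right (e1.trans e2) _)
    obtain ⟨a1, a2⟩ := hC1 f i
    obtain ⟨b1, b2⟩ := hC2 f (i+1)
    simp only [← hq, ← hh] at a1 a2 b1 b2
    have key : hl (EC h N F) i + q * hl (EC h ((M ⧸ N) ⧸ Rg (M ⧸ N) b 1) F) (i+1) ≤ 
      (((C1 * q ^ l.length) + q * (C2 * q ^ l.length) : ℕ) : ℕ∞) := by
      push_cast
      push_cast at a1 b1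
      gcongr
    have hq1 : 1 ≤ q := Nat.one_le_pow _ _ (Fact.out (p := p.Prime)).pos
    constructor
    · refine e3.trans (key.trans ?_)
      norm_cast
      rw [List.length_cons, pow_succ]
      nlinarith [Nat.zero_le (C1 * q ^ l.length)]
    · intro hni
      have b3 := b2 (by rw [List.length_cons] at hni; omega)
      have key : hl (EC h N F) i + q * hl (EC h ((M ⧸ N) ⧸ Rg (M ⧸ N) b 1) F) (i+1) ≤ 
        (((C1 * q ^ l.length) + (C2 * q ^ l.length) : ℕ) : ℕ∞) := by
        push_cast
        push_cast at a1 b3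
        gcongr
      refine (mul_le_mul_right (e3.trans key) _).trans ?_
      norm_cast
      rw [List.length_cons, pow_succ]
      apply le_of_eq
      ring
end
end FM

end

section
open CategoryTheory

namespace FM
section
variable {A : Type} [CommRing A]

/-- `a` kills the homology in degree `k` -/
def Zk (F : ChainComplex (FM A) ℕ) (a : A) (k : ℕ) : Prop :=
  ∀ v : (F.X k).ι → A, (mat (F.d k (k-1))).mulVec v = 0 → ∃ w, (mat (F.d (k+1) k)).mulVec w = a • v

/-- the other half of the homotopy -/
def Dk (F : ChainComplex (FM A) ℕ) (t : ∀ k, F.X k ⟶ F.X (k+1)) (k : ℕ) : F.X k ⟶ F.X k :=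
  Nat.rec (motive := fun k => F.X k ⟶ F.X k) 0 (fun k _ => F.d (k+1) k ≫ t k) k

lemma Dk_zero (F : ChainComplex (FM A) ℕ) (t : ∀ k, F.X k ⟶ F.X (k+1)) : Dk F t 0 = 0 := rfl
lemma Dk_succ (F : ChainComplex (FM A) ℕ) (t : ∀ k, F.X k ⟶ F.X (k+1)) (k : ℕ) :
    Dk F t (k+1) = F.d (k+1) k ≫ t k := rfl

lemma d_Dk (F : ChainComplex (FM A) ℕ) (t : ∀ k, F.X k ⟶ F.X (k+1)) (k : ℕ) :
    F.d (k+1) k ≫ Dk F t k = 0 := by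
  cases k with
  | zero => rw [Dk_zero, Limits.comp_zero]
  | succ k => rw [Dk_succ, ← Category.assoc, F.d_comp_d, Limits.zero_comp]

lemma Zk.lift {F : ChainComplex (FM A) ℕ} {a : A} {k : ℕ} (h : Zk F a k) {Y : FM A}
    (g : Y ⟶ F.X k) (hg : g ≫ F.d k (k-1) = 0) : ∃ w : Y ⟶ F.X (k+1), w ≫ F.d (k+1) k = g ≫ scal _ a := by
  have h1 : ∀ j : Y.ι, (mat (F.d k (k-1))).mulVec (fun i => mat g i j) = 0 := by
    intro j
    have e : mat (F.d k (k-1)) * mat g = 0 := by rw [← mat_comp, hg, mat_zero]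
    ext i
    exact congrFun (congrFun e i) j
  choose w hw using fun j => h _ (h1 j)
  refine ⟨hom (Matrix.of fun i j => w j i), ?_⟩
  apply mat_inj
  rw [mat_comp, mat_comp, mat_scal, mat_hom, Matrix.smul_mul, Matrix.one_mul]
  ext i j
  exact congrFun (hw j) i

lemma NH_lem (F : ChainComplex (FM A) ℕ) (a : A) (j : ℕ) (hz : ∀ k < j, Zk F a k) :
    ∃ t : ∀ k, F.X k ⟶ F.X (k+1), ∀ k < j, t k ≫ F.d (k+1) k + Dk F t k = scal _ (a ^ j) := by
  induction j with
  | zero => exact ⟨fun k => 0, fun k hk => absurd hk (by omega)⟩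
  | succ j ih =>
    obtain ⟨t, ht⟩ := ih fun k hk => hz k (by omega)
    have h0 : (scal _ (a ^ j) - Dk F t j) ≫ F.d j (j-1) = 0 := by
      cases j with
      | zero => rw [F.shape _ _ (by simp), Limits.comp_zero]
      | succ i =>
        change (scal _ (a ^ (i+1)) - Dk F t (i+1)) ≫ F.d (i+1) i = 0
        have e := ht i (by omega)
        rw [Preadditive.sub_comp, Dk_succ, Category.assoc, scal_comp, ← e, Preadditive.comp_add,
          d_Dk, add_zero, sub_self]
    obtain ⟨w, hw⟩ := (hz j (by omega)).lift _ h0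
    have hsc : ∀ X : FM A, scal X (a ^ (j+1)) = scal X (a^j) ≫ scal X a := by
      intro X
      apply mat_inj
      simp [pow_succ, mul_smul]
      try rw [smul_comm]
    let t' : ∀ k, F.X k ⟶ F.X (k+1) := fun k => if h : k = j then h ▸ w else t k ≫ scal _ a
    have ht'j : t' j = w := by simp [t']
    have ht' : ∀ k, k ≠ j → t' k = t k ≫ scal _ a := fun k hk => by simp [t', hk]
    have hD : ∀ k, k ≤ j → Dk F t' k = Dk F t k ≫ scal _ a := by
      intro k hk
      cases k with
      | zero => rw [Dk_zero, Dk_zero, Limits.zero_comp]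
      | succ k => rw [Dk_succ, Dk_succ, ht' k (by omega), Category.assoc]
    refine ⟨t', fun k hk => ?_⟩
    rw [hD k (by omega), hsc]
    by_cases hkj : k = j
    · subst hkj
      rw [ht'j, hw, ← Preadditive.add_comp, sub_add_cancel]
    · rw [ht' k hkj, Category.assoc, scal_comp, ← Category.assoc, ← Preadditive.add_comp, ht k (by omega)]

lemma NHT_of (F : ChainComplex (FM A) ℕ) (n : ℕ) (hn : ∀ i, n < i → IsEmpty (F.X i).ι) (a : A)
    (hz : ∀ k ≤ n, Zk F a k) : NHT F (a ^ (n+1)) := by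
  obtain ⟨t, ht⟩ := NH_lem F a (n+1) (fun k hk => hz k (by omega))
  have key : ∀ k, t k ≫ F.d (k+1) k + Dk F t k = scal _ (a ^ (n+1)) := by
    intro k
    by_cases hk : k < n + 1
    · exact ht k hk
    · haveI := hn k (by omega)
      apply mat_inj
      ext i
      exact isEmptyElim i
  refine ⟨t, ?_, fun k => key (k+1)⟩
  have := key 0
  rwa [Dk_zero, add_zero] at this

lemma Zk.mono {F : ChainComplex (FM A) ℕ} {a : A} {k : ℕ} (h : Zk F a k) (c : A) : Zk F (c * a) k := by
  intro v hv
  obtain ⟨w, hw⟩ := h v hv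
  exact ⟨c • w, by rw [Matrix.mulVec_smul, hw, mul_smul]⟩

lemma NHT_pow (F : ChainComplex (FM A) ℕ) (n : ℕ) (hn : ∀ i, n < i → IsEmpty (F.X i).ι) (y : A)
    (hz : ∀ k, ∃ N : ℕ, Zk F (y ^ N) k) : ∃ N : ℕ, NHT F (y ^ N) := by
  choose N hN using hz
  refine ⟨(∑ k ∈ Finset.range (n+1), N k) * (n+1), ?_⟩
  rw [pow_mul]
  refine NHT_of F n hn _ fun k hk => ?_
  have h1 := Finset.single_le_sum (f := N) (fun _ _ => Nat.zero_le _) (Finset.mem_range.2 (show k < n+1 by omega))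
  have := (hN k).mono (y ^ ((∑ k ∈ Finset.range (n+1), N k) - N k))
  rwa [← pow_add, Nat.sub_add_cancel h1] at this

end
end FM

end

section
open IsLocalRing

lemma len_step {R : Type} [CommRing R] [IsNoetherianRing R] [IsLocalRing R] (q q' : Ideal R) (hq : q.IsPrime)
    (hlt : q < q') : ∃ k : ℕ, ∀ t : ℕ,
    Module.length R (R ⧸ (q ⊔ maximalIdeal R ^ t)) + Module.length R (R ⧸ (q' ⊔ maximalIdeal R ^ (t+k)))
      ≤ Module.length R (R ⧸ (q ⊔ maximalIdeal R ^ (t+k))) := by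
  obtain ⟨hle, x, hx', hx⟩ := SetLike.lt_iff_le_and_exists.1 hlt
  obtain ⟨k, hk⟩ := Ideal.exists_pow_inf_eq_pow_smul (maximalIdeal R)
    (LinearMap.range (LinearMap.lsmul R (R ⧸ q) x))
  refine ⟨k, fun t => ?_⟩
  set J := q ⊔ maximalIdeal R ^ (t+k) with hJ
  let φ : R →ₗ[R] R ⧸ J := (Submodule.mkQ J).comp (LinearMap.lsmul R R x)
  have hJ' : J ≤ q' ⊔ maximalIdeal R ^ (t+k) := sup_le_sup_right hle _
  let ψ : (R ⧸ J) →ₗ[R] R ⧸ (q' ⊔ maximalIdeal R ^ (t+k)) := Submodule.factor hJ'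
  have e1 := Module.length_eq_add_of_exact (LinearMap.ker ψ).subtype ψ
    (Submodule.injective_subtype _) (Submodule.factor_surjective _) (LinearMap.exact_subtype_ker_map ψ)
  have hr : LinearMap.range φ ≤ LinearMap.ker ψ := by
    rintro _ ⟨y, rfl⟩
    rw [LinearMap.mem_ker]
    change Submodule.Quotient.mk (x * y) = _
    rw [Submodule.Quotient.mk_eq_zero]
    exact Ideal.mem_sup_left (Ideal.mul_mem_right _ _ hx')
  have e2 : Module.length R (LinearMap.range φ) ≤ Module.length R (LinearMap.ker ψ) :=
    Module.length_le_of_injective (Submodule.inclusion hr) (Submodule.inclusion_injective hr)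
  have hker : LinearMap.ker φ ≤ q ⊔ maximalIdeal R ^ t := by
    intro y hy
    have hy : x * y ∈ J := by
      rw [LinearMap.mem_ker] at hy
      exact (Submodule.Quotient.mk_eq_zero _).1 hy
    obtain ⟨a, ha, b, hb, hab⟩ := Submodule.mem_sup.1 hy
    have h1 : (Submodule.Quotient.mk (x * y) : R ⧸ q) ∈ (maximalIdeal R ^ (t+k) • ⊤ : Submodule R (R ⧸ q)) := by
      rw [← hab]
      have : (Submodule.Quotient.mk (a + b) : R ⧸ q) = b • Submodule.Quotient.mk 1 := by
        rw [← Submodule.Quotient.mk_smul, smul_eq_mul, mul_one, Submodule.Quotient.mk_add,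
          (Submodule.Quotient.mk_eq_zero q).2 ha, zero_add]
      rw [this]
      exact Submodule.smul_mem_smul hb trivial
    have h2 : (Submodule.Quotient.mk (x * y) : R ⧸ q) ∈ LinearMap.range (LinearMap.lsmul R (R ⧸ q) x) :=
      ⟨Submodule.Quotient.mk y, rfl⟩
    have h3 := Submodule.mem_inf.2 ⟨h1, h2⟩
    rw [hk (t+k) (by omega), Nat.add_sub_cancel] at h3
    have h4 : (Submodule.Quotient.mk (x * y) : R ⧸ q) ∈ (maximalIdeal R ^ t) • LinearMap.range (LinearMap.lsmul R (R ⧸ q) x) :=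
      Submodule.smul_mono le_rfl inf_le_right h3
    rw [LinearMap.range_eq_map, ← Submodule.map_smul''] at h4
    obtain ⟨z, hz, hzx⟩ := h4
    have h5 : (maximalIdeal R ^ t • ⊤ : Submodule R (R ⧸ q)) ≤ Submodule.map (Submodule.mkQ q) (maximalIdeal R ^ t) := by
      rw [Submodule.smul_le]
      rintro r hr n -
      obtain ⟨n, rfl⟩ := Submodule.mkQ_surjective _ n
      exact ⟨r * n, Ideal.mul_mem_right _ _ hr, rfl⟩
    obtain ⟨z, hz', rfl⟩ := h5 hz
    have h6 : x * z - x * y ∈ q := (Submodule.Quotient.eq q).1 hzx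
    rw [← mul_sub] at h6
    have h7 := (hq.mem_or_mem h6).resolve_left hx
    have : y = -(z - y) + z := by ring
    rw [this]
    exact Submodule.add_mem_sup (q.neg_mem h7) hz'
  have e3 : Module.length R (R ⧸ (q ⊔ maximalIdeal R ^ t)) ≤ Module.length R (LinearMap.range φ) := by
    rw [← (φ.quotKerEquivRange).length_eq]
    exact Module.length_le_of_surjective (Submodule.factor hker) (Submodule.factor_surjective _)
  rw [e1]
  exact add_le_add_left (e3.trans e2) _

lemma len_pos {R : Type} [CommRing R] [IsLocalRing R] (q : Ideal R) (hq : q.IsPrime) (t : ℕ) (ht : 1 ≤ t) :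
    1 ≤ Module.length R (R ⧸ (q ⊔ maximalIdeal R ^ t)) := by
  have h1 : q ⊔ maximalIdeal R ^ t ≠ ⊤ := by
    intro h
    have : q ⊔ maximalIdeal R ^ t ≤ maximalIdeal R :=
      sup_le (le_maximalIdeal hq.ne_top) (Ideal.pow_le_self (by omega))
    rw [h] at this
    exact (inferInstance : (maximalIdeal R).IsMaximal).ne_top (top_le_iff.1 this)
  haveI : Nontrivial (R ⧸ (q ⊔ maximalIdeal R ^ t)) := Ideal.Quotient.nontrivial_iff.2 h1
  exact ENat.one_le_iff_ne_zero.2 (fun h => not_subsingleton _ (Module.length_eq_zero_iff.1 h))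

lemma pow_bd (s d : ℕ) : (s+1)^(d+1) ≤ s^(d+1) + (d+1) * (s+1)^d := by
  induction d with
  | zero => simp
  | succ d ih =>
    have h1 : s * s^(d+1) = s^(d+2) := by ring
    have h2 : s^(d+1) ≤ (s+1)^(d+1) := Nat.pow_le_pow_left (by omega) _
    calc (s+1)^(d+2) = s * (s+1)^(d+1) + (s+1)^(d+1) := by ring
      _ ≤ s * (s^(d+1) + (d+1) * (s+1)^d) + (s+1)^(d+1) := by gcongr
      _ = s^(d+2) + (d+1) * (s * (s+1)^d) + (s+1)^(d+1) := by ring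
      _ ≤ s^(d+2) + (d+1) * ((s+1) * (s+1)^d) + (s+1)^(d+1) := by gcongr; omega
      _ = _ := by ring

lemma len_chain {R : Type} [CommRing R] [IsNoetherianRing R] [IsLocalRing R] (d : ℕ) :
    ∀ (s : ℕ → Ideal R) (hp : ∀ i ≤ d, (s i).IsPrime) (hs : ∀ i < d, s i < s (i+1)),
      ∃ c : ℕ, ∀ t : ℕ, 1 ≤ t → ((t ^ d : ℕ) : ℕ∞) ≤ c * Module.length R (R ⧸ (s 0 ⊔ maximalIdeal R ^ t)) := by
  induction d with
  | zero =>
    intro s hp hs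
    refine ⟨1, fun t ht => ?_⟩
    simpa using len_pos (s 0) (hp 0 le_rfl) t ht
  | succ d ih =>
    intro s hp hs
    obtain ⟨c, hc⟩ := ih (fun i => s (i+1)) (fun i hi => hp (i+1) (by omega)) (fun i hi => hs (i+1) (by omega))
    change ∀ t : ℕ, 1 ≤ t → ((t ^ d : ℕ) : ℕ∞) ≤ c * Module.length R (R ⧸ (s 1 ⊔ maximalIdeal R ^ t)) at hc
    obtain ⟨k0, hk0⟩ := len_step (s 0) (s 1) (hp 0 (by omega)) (hs 0 (by omega))
    set L : ℕ → ℕ∞ := fun t => Module.length R (R ⧸ (s 0 ⊔ maximalIdeal R ^ t)) with hL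
    set L' : ℕ → ℕ∞ := fun t => Module.length R (R ⧸ (s 1 ⊔ maximalIdeal R ^ t)) with hL'
    have hmono : ∀ a b, a ≤ b → L a ≤ L b := fun a b hab =>
      Module.length_le_of_surjective (Submodule.factor (sup_le_sup_left (Ideal.pow_le_pow_right hab) _)) (Submodule.factor_surjective _)
    have hstep : ∀ t, L t + L' (t+(k0+1)) ≤ L (t + (k0+1)) := by
      intro t
      have := hk0 (t+1)
      rw [show t + 1 + k0 = t + (k0+1) by ring] at this
      exact (add_le_add_left (hmono t (t+1) (by omega)) _).trans this
    obtain ⟨k, hk⟩ : ∃ k, k = k0 + 1 := ⟨_, rfl⟩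
    rw [← hk] at hstep
    have hind : ∀ s : ℕ, ((s ^ (d+1) : ℕ) : ℕ∞) ≤ ((c * (d+1) : ℕ) : ℕ∞) * L (k * s) := by
      intro s
      induction s with
      | zero => simp
      | succ s ihs =>
        have h1 := hc (k * (s+1)) (by rw [hk]; exact Nat.mul_pos (by omega) (by omega))
        have h2 : (((s+1)^d : ℕ) : ℕ∞) ≤ c * L' (k * (s+1)) := by
          refine le_trans ?_ h1
          norm_cast
          apply Nat.pow_le_pow_left
          exact Nat.le_mul_of_pos_left _ (by omega)
        have h3 := hstep (k * s)
        rw [show k * s + k = k * (s+1) by ring] at h3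
        calc (((s+1)^(d+1) : ℕ) : ℕ∞) ≤ ((s^(d+1) + (d+1) * (s+1)^d : ℕ) : ℕ∞) := by
              exact_mod_cast pow_bd s d
          _ = ((s^(d+1) : ℕ) : ℕ∞) + ((d+1 : ℕ) : ℕ∞) * (((s+1)^d : ℕ) : ℕ∞) := by push_cast; rfl
          _ ≤ ((c * (d+1) : ℕ) : ℕ∞) * L (k * s) + ((d+1 : ℕ) : ℕ∞) * (c * L' (k * (s+1))) := by gcongr
          _ = ((c * (d+1) : ℕ) : ℕ∞) * (L (k * s) + L' (k * (s+1))) := by push_cast; ring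
          _ ≤ _ := by gcongr
    refine ⟨(2 * k)^(d+1) * (c * (d+1)) + k^(d+1), fun t ht => ?_⟩
    by_cases htk : t < k
    · have h1 := len_pos (s 0) (hp 0 (by omega)) t ht
      calc ((t^(d+1) : ℕ) : ℕ∞) ≤ (((2 * k)^(d+1) * (c * (d+1)) + k^(d+1) : ℕ) : ℕ∞) * 1 := by
            rw [mul_one]; norm_cast
            exact le_add_left (Nat.pow_le_pow_left (by omega) _)
        _ ≤ _ := by gcongr
    · have h1 : t ≤ 2 * k * (t / k) := by
        have a1 := Nat.div_add_mod t k
        have a2 := Nat.mod_lt t (show 0 < k by omega)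
        have a3 : 1 ≤ t / k := (Nat.one_le_div_iff (by omega)).2 (by omega)
        nlinarith
      calc ((t^(d+1) : ℕ) : ℕ∞) ≤ (((2 * k * (t/k))^(d+1) : ℕ) : ℕ∞) := by
              exact_mod_cast Nat.pow_le_pow_left h1 _
        _ = (((2 * k)^(d+1) : ℕ) : ℕ∞) * (((t/k)^(d+1) : ℕ) : ℕ∞) := by rw [mul_pow]; push_cast; rfl
        _ ≤ (((2 * k)^(d+1) : ℕ) : ℕ∞) * (((c * (d+1) : ℕ) : ℕ∞) * L (k * (t/k))) := by gcongr; exact hind _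
        _ ≤ (((2 * k)^(d+1) : ℕ) : ℕ∞) * (((c * (d+1) : ℕ) : ℕ∞) * L t) := by
              gcongr; exact hmono _ _ (Nat.mul_div_le t k)
        _ = (((2 * k)^(d+1) * (c * (d+1)) : ℕ) : ℕ∞) * L t := by push_cast; ring
        _ ≤ _ := by gcongr; omega

lemma len_low {R : Type} [CommRing R] [IsNoetherianRing R] [IsLocalRing R] (d : ℕ)
    (hd : (d : WithBot ℕ∞) ≤ ringKrullDim R) :
      ∃ c : ℕ, ∀ t : ℕ, 1 ≤ t → ((t ^ d : ℕ) : ℕ∞) ≤ c * Module.length R (R ⧸ (maximalIdeal R ^ t)) := by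
  obtain ⟨l, hl⟩ := Order.le_krullDim_iff.1 hd
  obtain ⟨c, hc⟩ := len_chain d (fun i => if h : i ≤ d then (l ⟨i, by omega⟩).asIdeal else ⊤)
    (fun i hi => by simp only [hi, dif_pos]; exact (l _).isPrime)
    (fun i hi => by
      have h1 : i ≤ d := by omega
      have h2 : i + 1 ≤ d := by omega
      simp only [h1, h2, dif_pos]
      exact l.strictMono (by simp))
  refine ⟨c, fun t ht => (hc t ht).trans ?_⟩
  gcongr
  exact Module.length_le_of_surjective (Submodule.factor le_sup_right) (Submodule.factor_surjective _)

end

section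
open CategoryTheory

lemma sc_concrete {A : Type} [CommRing A] (S : ShortComplex (ModuleCat A)) {H : ModuleCat A}
    (e : H ≅ S.homology) :
    ∃ π : LinearMap.ker S.g.hom →ₗ[A] H, Function.Surjective π ∧
      ∀ z, π z = 0 ↔ ∃ w, S.f.hom w = z.1 := by
  let T : ModuleCat A := ModuleCat.of A (LinearMap.ker S.g.hom ⧸ LinearMap.range S.moduleCatToCycles)
  let e2 : H ≅ T := e ≪≫ S.moduleCatHomologyIso
  let e' : H ≃ₗ[A] (LinearMap.ker S.g.hom ⧸ LinearMap.range S.moduleCatToCycles) := e2.toLinearEquiv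
  refine ⟨e'.symm.toLinearMap.comp (LinearMap.range S.moduleCatToCycles).mkQ, ?_, ?_⟩
  · exact e'.symm.surjective.comp (Submodule.mkQ_surjective _)
  · intro z
    rw [LinearMap.comp_apply, LinearEquiv.coe_coe, LinearEquiv.map_eq_zero_iff, Submodule.mkQ_apply, Submodule.Quotient.mk_eq_zero]
    constructor
    · rintro ⟨w, hw⟩
      exact ⟨w, congrArg Subtype.val hw⟩
    · rintro ⟨w, hw⟩
      exact ⟨w, Subtype.ext hw⟩

lemma hom_concrete {A : Type} [CommRing A] (C : ChainComplex (ModuleCat A) ℕ) (i : ℕ) :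
    ∃ π : LinearMap.ker (C.d i (i-1)).hom →ₗ[A] C.homology i, Function.Surjective π ∧
      ∀ z, π z = 0 ↔ ∃ w, (C.d (i+1) i).hom w = z.1 :=
  sc_concrete (C.sc' (i+1) i (i-1)) (C.homologyIsoSc' (i+1) i (i-1) (by simp) (by cases i <;> simp))

lemma hl_zero {A : Type} [CommRing A] (C : ChainComplex (ModuleCat.{0} A) ℕ) (i : ℕ)
    (h : ∀ v, (C.d i (i-1)).hom v = 0 → ∃ w, (C.d (i+1) i).hom w = v) : hl C i = 0 := by
  obtain ⟨π, hs, hk⟩ := hom_concrete C i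
  have : Subsingleton (C.homology i) := by
    refine ⟨fun a b => ?_⟩
    obtain ⟨a, rfl⟩ := hs a
    obtain ⟨b, rfl⟩ := hs b
    rw [(hk a).2 (h _ a.2), (hk b).2 (h _ b.2)]
  exact Module.length_eq_zero_iff.2 this

lemma hl_ge {A : Type} [CommRing A] (C : ChainComplex (ModuleCat.{0} A) ℕ) (i : ℕ)
    {Q : Type} [AddCommGroup Q] [Module A Q] (μ : C.X i →ₗ[A] Q)
    (h0 : ∀ w, μ ((C.d (i+1) i).hom w) = 0) (h1 : ∀ z, ∃ v, (C.d i (i-1)).hom v = 0 ∧ μ v = z) :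
    Module.length A Q ≤ hl C i := by
  obtain ⟨π, hs, hk⟩ := hom_concrete C i
  have hle : LinearMap.ker π ≤ LinearMap.ker (μ ∘ₗ (LinearMap.ker (C.d i (i-1)).hom).subtype) := by
    intro z hz
    obtain ⟨w, hw⟩ := (hk z).1 hz
    rw [LinearMap.mem_ker, LinearMap.comp_apply]
    exact (congrArg μ hw.symm).trans (h0 w)
  let g := (LinearMap.ker π).liftQ _ hle
  have hg : Function.Surjective g := by
    intro z
    obtain ⟨v, hv, hz⟩ := h1 z
    exact ⟨Submodule.Quotient.mk ⟨v, hv⟩, hz⟩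
  refine (Module.length_le_of_surjective g hg).trans (le_of_eq ?_)
  exact (π.quotKerEquivOfSurjective hs).length_eq

namespace FM
section
variable {A : Type} [CommRing A] [IsLocalRing A] [IsNoetherianRing A]

lemma find_z (F : ChainComplex (FM A) ℕ) (j : ℕ) (hz : ∀ k < j, Zk F 1 k) (hj : ¬ Zk F 1 j) :
    ∃ z : (F.X j).ι → A, (mat (F.d j (j-1))).mulVec z = 0 ∧
      ∀ w, ∃ i, z i - (mat (F.d (j+1) j)).mulVec w i ∉ IsLocalRing.maximalIdeal A := by
  obtain ⟨t, ht⟩ := NH_lem F 1 j hz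
  let r : F.X j ⟶ F.X j := 𝟙 _ - Dk F t j
  have hr : r ≫ F.d j (j-1) = 0 := by
    cases j with
    | zero => rw [F.shape _ _ (by simp), Limits.comp_zero]
    | succ i =>
      change (𝟙 _ - Dk F t (i+1)) ≫ F.d (i+1) i = 0
      have e : t i ≫ F.d (i+1) i + Dk F t i = 𝟙 _ := by
        rw [ht i (by omega)]
        apply mat_inj; simp
      rw [Preadditive.sub_comp, Dk_succ, Category.assoc, eq_sub_of_add_eq e, Preadditive.comp_sub,
          d_Dk, Category.comp_id, Category.id_comp, sub_zero, sub_self]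
  have hdr : F.d (j+1) j ≫ r = F.d (j+1) j := by
    rw [Preadditive.comp_sub, d_Dk, sub_zero, Category.comp_id]
  set D := mat (F.d (j+1) j) with hD
  set D' := mat (F.d j (j-1)) with hD'
  have hr' : D' * mat r = 0 := by rw [hD', ← mat_comp, hr, mat_zero]
  have hdr' : mat r * D = D := by rw [hD, ← mat_comp, hdr]
  have hrz : ∀ z, D'.mulVec z = 0 → (mat r).mulVec z = z := by
    intro z hz
    have e : (mat r) = 1 - mat (Dk F t j) := by
      change mat (𝟙 _ - Dk F t j) = _
      rw [sub_eq_add_neg, mat_add, mat_neg, mat_id, sub_eq_add_neg]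
    have e2 : (mat (Dk F t j)).mulVec z = 0 := by
      cases j with
      | zero => rw [Dk_zero, mat_zero, Matrix.zero_mulVec]
      | succ i =>
        have hz : (mat (F.d (i+1) i)).mulVec z = 0 := hz
        rw [Dk_succ, mat_comp, ← Matrix.mulVec_mulVec, hz, Matrix.mulVec_zero]
    rw [e, Matrix.sub_mulVec, e2, Matrix.one_mulVec, sub_zero]
  by_contra hcon
  push Not at hcon
  apply hj
  intro v hv
  rw [one_smul]
  let Z := LinearMap.ker D'.mulVecLin
  let N := LinearMap.range D.mulVecLin
  have key : Z ≤ N := by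
    refine Submodule.le_of_le_smul_of_le_jacobson_bot (I := IsLocalRing.maximalIdeal A) (IsNoetherian.noetherian _)
      (IsLocalRing.maximalIdeal_le_jacobson _) ?_
    intro z hz
    have hz : D'.mulVec z = 0 := hz
    obtain ⟨w, hw⟩ := hcon z hz
    have e1 : z = D.mulVec w + (mat r).mulVec (z - D.mulVec w) := by
      rw [Matrix.mulVec_sub, Matrix.mulVec_mulVec, hdr', hrz z hz, add_sub_cancel]
    rw [e1]
    refine Submodule.add_mem_sup ⟨w, rfl⟩ ?_
    have e2 : (mat r).mulVec (z - D.mulVec w) = ∑ i, (z i - D.mulVec w i) • (mat r).col i := by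
      ext k
      simp only [Matrix.mulVec, dotProduct, Finset.sum_apply, Pi.smul_apply, smul_eq_mul]
      exact Finset.sum_congr rfl fun i _ => mul_comm _ _
    rw [e2]
    refine Submodule.sum_mem _ fun i _ => Submodule.smul_mem_smul (hw i) ?_
    change D'.mulVec ((mat r).col i) = 0
    ext k
    exact congrFun (congrFun hr' k) i
  exact key hv

lemma find_fun (F : ChainComplex (FM A) ℕ) (j : ℕ) (hz : ∀ k < j, Zk F 1 k) (hj : ¬ Zk F 1 j) :
    ∃ z c : (F.X j).ι → A, (mat (F.d j (j-1))).mulVec z = 0 ∧ ∑ i, c i * z i = 1 ∧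
      ∀ l, ∑ i, c i * (mat (F.d (j+1) j)) i l ∈ IsLocalRing.maximalIdeal A := by
  obtain ⟨z, hz, hw⟩ := find_z F j hz hj
  set D := mat (F.d (j+1) j) with hD
  let ρ := IsLocalRing.residue A
  let K := IsLocalRing.ResidueField A
  let P := LinearMap.range (D.map ρ).mulVecLin
  have hx : (fun i => ρ (z i)) ∉ P := by
    rintro ⟨w, hw'⟩
    choose w1 hw1 using fun l => IsLocalRing.residue_surjective (w l)
    obtain ⟨i, hi⟩ := hw w1
    apply hi
    rw [← IsLocalRing.residue_eq_zero_iff, map_sub, sub_eq_zero]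
    refine (congrFun hw' i).symm.trans ?_
    change ∑ l, ρ (D i l) * w l = ρ (∑ l, D i l * w1 l)
    rw [map_sum]
    exact Finset.sum_congr rfl fun l _ => by rw [map_mul]; exact congrArg _ (hw1 l).symm
  obtain ⟨f, hf, hfP⟩ := Submodule.exists_dual_map_eq_bot_of_notMem hx inferInstance
  choose c hc using fun i => IsLocalRing.residue_surjective (f (Pi.single i 1))
  have hfv : ∀ v : (F.X j).ι → K, f v = ∑ i, ρ (c i) * v i := by
    intro v
    conv_lhs => rw [pi_eq_sum_univ' v]
    rw [map_sum]
    refine Finset.sum_congr rfl fun i _ => ?_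
    rw [show ρ (c i) = f (Pi.single i 1) from hc i, map_smul, smul_eq_mul, mul_comm]
  have hu : IsUnit (∑ i, c i * z i) := by
    by_contra hu
    apply hf
    rw [hfv]
    have : ρ (∑ i, c i * z i) = 0 := (IsLocalRing.residue_eq_zero_iff _).2 hu
    rw [← this, map_sum]
    simp
  obtain ⟨u, hu⟩ := hu
  refine ⟨(↑u⁻¹ : A) • z, c, ?_, ?_, ?_⟩
  · rw [Matrix.mulVec_smul, hz, smul_zero]
  · have : ∑ i, c i * ((↑u⁻¹ : A) • z) i = (↑u⁻¹ : A) * ∑ i, c i * z i := by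
      rw [Finset.mul_sum]
      exact Finset.sum_congr rfl fun i _ => by simp; ring
    rw [this, ← hu, Units.inv_mul]
  · intro l
    rw [← IsLocalRing.residue_eq_zero_iff, map_sum]
    have h1 : f ((D.map ρ).mulVec (Pi.single l 1)) ∈ P.map f := ⟨_, ⟨_, rfl⟩, rfl⟩
    rw [hfP, Submodule.mem_bot, hfv] at h1
    rw [← h1]
    refine Finset.sum_congr rfl fun i _ => ?_
    rw [map_mul]
    simp
    rfl

variable {B : Type} [CommRing B] [Algebra A B] (h : A →+* B)

lemma EC_zero (F : ChainComplex (FM A) ℕ) (j : ℕ) (hz : ∀ k < j, Zk F 1 k) (i : ℕ) (hi : i < j) :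
    hl (EC h B F) i = 0 := by
  obtain ⟨t, ht⟩ := NH_lem F 1 j hz
  apply hl_zero
  intro (v : (F.X i).ι → B) hv
  have hv : act A h B (mat (F.d i (i-1))) v = 0 := hv
  refine ⟨act A h B (mat (t i)) v, ?_⟩
  change act A h B (mat (F.d (i+1) i)) (act A h B (mat (t i)) v) = v
  have e : mat (F.d (i+1) i) * mat (t i) + mat (Dk F t i) = 1 := by
    rw [← mat_comp, ← mat_add, ht i hi]; simp
  have e2 : act A h B (mat (Dk F t i)) v = 0 := by
    cases i with
    | zero =>
      ext k
      rw [Dk_zero, act_apply, mat_zero]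
      simp
    | succ i =>
      have hv : act A h B (mat (F.d (i+1) i)) v = 0 := hv
      rw [Dk_succ, mat_comp, act_mul, hv, map_zero]
  have e3 := act_one (A := A) h B v
  rw [← e] at e3
  rw [← act_mul]
  refine Eq.trans ?_ e3
  ext k
  have e4 := congrFun e2 k
  simp only [act_apply, Matrix.add_apply, map_add, add_smul, Finset.sum_add_distrib] at e4 ⊢
  rw [e4]
  simp

lemma EC_ge (F : ChainComplex (FM A) ℕ) (j : ℕ) (hz : ∀ k < j, Zk F 1 k) (hj : ¬ Zk F 1 j)
    (I : Ideal B) (hI : ∀ y ∈ IsLocalRing.maximalIdeal A, h y ∈ I) :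
    Module.length A (B ⧸ I) ≤ hl (EC h B F) j := by
  obtain ⟨z, c, hz, h1, h2⟩ := find_fun F j hz hj
  let μ : ((F.X j).ι → B) →ₗ[A] B ⧸ I := (I.mkQ.restrictScalars A) ∘ₗ
    { toFun := fun v => ∑ i, h (c i) * v i
      map_add' := fun v w => by simp [mul_add, Finset.sum_add_distrib]
      map_smul' := fun a v => by simp [Finset.smul_sum] }
  refine hl_ge (EC h B F) j (Q := B ⧸ I) μ ?_ ?_
  · intro (w : (F.X (j+1)).ι → B)
    refine (Submodule.Quotient.mk_eq_zero I).2 ?_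
    change ∑ i, h (c i) * (∑ l, h (mat (F.d (j+1) j) i l) * w l) ∈ I
    have : ∑ i, h (c i) * (∑ l, h (mat (F.d (j+1) j) i l) * w l) = ∑ l, h (∑ i, c i * mat (F.d (j+1) j) i l) * w l := by
      simp only [Finset.mul_sum, map_sum, Finset.sum_mul, map_mul, mul_assoc]
      rw [Finset.sum_comm]
    rw [this]
    exact I.sum_mem fun l _ => I.mul_mem_right _ (hI _ (h2 l))
  · intro q
    obtain ⟨b, rfl⟩ := Submodule.mkQ_surjective I q
    refine ⟨(fun i => h (z i) * b : (F.X j).ι → B), ?_, ?_⟩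
    · refine funext fun (k : (F.X (j-1)).ι) => ?_
      change ∑ i, h (mat (F.d j (j-1)) k i) * (h (z i) * b) = 0
      have := congrFun hz k
      have e : ∑ i, h (mat (F.d j (j-1)) k i) * (h (z i) * b) = h (∑ i, mat (F.d j (j-1)) k i * z i) * b := by
        simp only [map_sum, Finset.sum_mul, map_mul, mul_assoc]
      rw [e]
      rw [show ∑ i, mat (F.d j (j-1)) k i * z i = 0 from this]
      simp
    · change I.mkQ (∑ i, h (c i) * (h (z i) * b)) = I.mkQ b
      have e : ∑ i, h (c i) * (h (z i) * b) = h (∑ i, c i * z i) * b := by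
        simp only [map_sum, Finset.sum_mul, map_mul, mul_assoc]
      rw [e, h1]
      simp
end
end FM

end

section
open CategoryTheory

lemma arith_core (n d j q C c : ℕ) (L : ℕ → ℕ) (hq : 1 ≤ q) (hj : j ≤ n)
    (hs : ∑ i ∈ Finset.range (n+1), (-1 : ℤ) ^ i * (L i : ℤ) = 0)
    (h0 : ∀ i, i ≠ j → q * L i ≤ C * q ^ d) (h1 : q ^ d ≤ c * L j) : q ≤ c * (n * C) := by
  have hjm : j ∈ Finset.range (n+1) := Finset.mem_range.2 (by omega)
  rw [← Finset.add_sum_erase _ _ hjm] at hs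
  have h2 : (L j : ℤ) ≤ ∑ i ∈ (Finset.range (n+1)).erase j, (L i : ℤ) := by
    have e : |(-1 : ℤ) ^ j * (L j : ℤ)| = L j := by simp [abs_mul]
    rw [← e, eq_neg_of_add_eq_zero_left hs, abs_neg]
    refine (Finset.abs_sum_le_sum_abs _ _).trans (le_of_eq ?_)
    exact Finset.sum_congr rfl fun i _ => by simp [abs_mul]
  have h3 : L j ≤ ∑ i ∈ (Finset.range (n+1)).erase j, L i := by exact_mod_cast h2
  have h4 : q * L j ≤ n * (C * q ^ d) := by
    calc q * L j ≤ q * ∑ i ∈ (Finset.range (n+1)).erase j, L i := Nat.mul_le_mul_left _ h3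
      _ = ∑ i ∈ (Finset.range (n+1)).erase j, q * L i := Finset.mul_sum _ _ _
      _ ≤ ∑ i ∈ (Finset.range (n+1)).erase j, C * q ^ d :=
        Finset.sum_le_sum fun i hi => h0 i (Finset.ne_of_mem_erase hi)
      _ = n * (C * q ^ d) := by
        rw [Finset.sum_const, Finset.card_erase_of_mem hjm]; simp
  have h5 : q ^ d * q ≤ q ^ d * (c * (n * C)) := by
    calc q ^ d * q ≤ (c * L j) * q := Nat.mul_le_mul_right _ h1
      _ = c * (q * L j) := by ring
      _ ≤ c * (n * (C * q ^ d)) := Nat.mul_le_mul_left _ h4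
      _ = _ := by ring
  exact Nat.le_of_mul_le_mul_left h5 (Nat.pow_pos (by omega))

namespace FM
section
variable {A : Type} [CommRing A] [IsLocalRing A] [IsNoetherianRing A] [IsDomain A]
variable {B : Type} [CommRing B] [Algebra A B] [IsLocalRing B] 

lemma core (p : ℕ) [Fact p.Prime] [CharP B p] {x : A} (hx : x ≠ 0)
    (hs : Function.Surjective (algebraMap A B))
    (hk : RingHom.ker (algebraMap A B) = Ideal.span {x})
    (F : ChainComplex (FM A) ℕ) (n : ℕ) (hn : ∀ i, n < i → IsEmpty (F.X i).ι)
    (hF : ∀ y ∈ IsLocalRing.maximalIdeal A, ∃ N : ℕ, NHT F (y ^ N))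
    (hne : ∃ j, ¬ Zk F 1 j) (d : ℕ) (hnd : n ≤ d) (hd : (d : WithBot ℕ∞) ≤ ringKrullDim B)
    (l : List A) (hld : l.length = d) (hlm : ∀ a ∈ l, a ∈ IsLocalRing.maximalIdeal A)
    (hl : ∀ I : Ideal A, I.IsPrime → (∀ a ∈ l, a ∈ I) → x ∈ I → IsLocalRing.maximalIdeal A ≤ I) : False := by
  haveI : Module.Finite A B := Module.Finite.of_surjective (Algebra.linearMap A B) hs
  haveI : IsNoetherianRing B := isNoetherianRing_of_surjective A B (algebraMap A B) hs
  classical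
  let j := Nat.find hne
  have hj : ¬ Zk F 1 j := Nat.find_spec hne
  have hz : ∀ k < j, Zk F 1 k := fun k hk => not_not.1 (Nat.find_min hne hk)
  have hjn : j ≤ n := by
    by_contra hjn
    haveI := hn j (by omega)
    exact hj fun v _ => ⟨0, funext fun i => isEmptyElim i⟩
  -- the list
  choose! N hN using hF
  have hann : ∀ I : Ideal A, I.IsPrime → (∀ a ∈ l.map (fun a => a ^ N a), a ∈ I) → Module.annihilator A B ≤ I →
        IsLocalRing.maximalIdeal A ≤ I := by
    intro I hI h1 h2
    refine hl I hI (fun a ha => hI.mem_of_pow_mem _ (h1 _ (List.mem_map.2 ⟨a, ha, rfl⟩))) (h2 ?_)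
    rw [Module.mem_annihilator]
    intro b
    have : algebraMap A B x = 0 := by
      rw [← RingHom.mem_ker, hk]; exact Ideal.mem_span_singleton_self x
    rw [Algebra.smul_def, this, zero_mul]
  obtain ⟨C, hC⟩ := bound (B := B) p F n hn (l.map (fun a => a ^ N a)) B hann (by
    intro a ha
    obtain ⟨a', ha', rfl⟩ := List.mem_map.1 ha
    exact hN a' (hlm a' ha'))
  rw [List.length_map, hld] at hC
  obtain ⟨c, hc⟩ := len_low d hd
  have key : ∀ f : ℕ, p ^ f ≤ c * (n * C) := by
    intro f
    have hq1 : 1 ≤ p ^ f := Nat.one_le_pow _ _ (Fact.out (p := p.Prime)).pos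
    set L := _root_.hl (EC (FM.hF A B p f) B F) with hL
    have hfin : ∀ i, L i ≠ ⊤ := fun i h => by
      have := (hC f i).1
      rw [← hL, h] at this
      exact absurd (top_le_iff.1 this) (ENat.coe_ne_top _)
    have hLi : ∀ i, L i = ((L i).toNat : ℕ∞) := fun i => (ENat.coe_toNat (hfin i)).symm
    refine arith_core n d j (p ^ f) C c (fun i => (L i).toNat) hq1 hjn ?_ ?_ ?_
    · rw [← chi_eq (l := L) (N := n+1)]
      · exact chi_EC p hx hs hk f F n hn (fun y hy => ⟨N y, hN y hy⟩)
      · intro i hi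
        haveI := hn i (by omega)
        have := EC_len (FM.hF A B p f) B F i
        simpa using this
    · intro i hij
      by_cases hlt : i < j
      · have : L i = 0 := EC_zero _ F j hz i hlt
        simp [this]
      · have h1 := (hC f i).2 (by omega)
        rw [← hL, hLi i] at h1
        exact_mod_cast h1
    · have h1 := hc (p ^ f) hq1
      have h2 : Module.length A (B ⧸ IsLocalRing.maximalIdeal B ^ (p ^ f)) ≤ L j := by
        refine EC_ge _ F j hz hj _ fun y hy => ?_
        rw [hF_apply, map_pow]
        refine Ideal.pow_mem_pow ?_ _
        haveI : IsLocalHom (algebraMap A B) := hs.isLocalHom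
        exact map_nonunit (algebraMap A B) y hy
      rw [Module.length_eq_of_surjective (R := B) hs] at h2
      have h3 := h1.trans (mul_le_mul_right h2 (c : ℕ∞))
      rw [hLi j] at h3
      exact_mod_cast h3
  have h1 := key (c * (n * C))
  have h2 := Nat.lt_pow_self (n := c * (n * C)) (Fact.out (p := p.Prime)).one_lt
  omega
end

section
variable {A : Type} [CommRing A] [IsLocalRing A] [IsNoetherianRing A] [IsDomain A]

theorem NIT_FM (p : ℕ) [Fact p.Prime] [CharP (IsLocalRing.ResidueField A) p]
    (F : ChainComplex (FM A) ℕ) (n : ℕ) (hn : ∀ i, n < i → IsEmpty (F.X i).ι)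
    (hF : ∀ y ∈ IsLocalRing.maximalIdeal A, ∀ k, ∃ N : ℕ, Zk F (y ^ N) k)
    (hne : ∃ j, ¬ Zk F 1 j) : ringKrullDim A ≤ n := by
  by_contra hcon
  have hpm : (p : A) ∈ IsLocalRing.maximalIdeal A := by
    rw [← IsLocalRing.residue_eq_zero_iff, map_natCast]
    exact CharP.cast_eq_zero _ p
  obtain ⟨x, hx0, hxm, hpx⟩ : ∃ x : A, x ≠ 0 ∧ x ∈ IsLocalRing.maximalIdeal A ∧ (p : A) ∈ Ideal.span {x} := by
    by_cases hp : (p : A) = 0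
    · obtain ⟨x, hx, hx0⟩ : ∃ x ∈ IsLocalRing.maximalIdeal A, x ≠ 0 := by
        by_contra h
        push Not at h
        apply hcon
        rw [ringKrullDim_eq_zero_of_isField (IsLocalRing.isField_iff_maximalIdeal_eq.2 ((Submodule.eq_bot_iff _).2 h))]
        exact_mod_cast Nat.zero_le n
      exact ⟨x, hx0, hx, by rw [hp]; exact zero_mem _⟩
    · exact ⟨p, hp, hpm, Ideal.mem_span_singleton_self _⟩
  let B := A ⧸ Ideal.span {x}
  have hle : Ideal.span {x} ≤ IsLocalRing.maximalIdeal A := by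
    rw [Ideal.span_singleton_le_iff_mem]; exact hxm
  have hne1 : Ideal.span {x} ≠ ⊤ := fun h => by
    rw [h] at hle
    exact (inferInstance : (IsLocalRing.maximalIdeal A).IsMaximal).ne_top (top_le_iff.1 hle)
  haveI : Nontrivial B := Ideal.Quotient.nontrivial_iff.2 hne1
  have hs : Function.Surjective (algebraMap A B) := Ideal.Quotient.mk_surjective
  haveI : IsLocalRing B := IsLocalRing.of_surjective' (algebraMap A B) hs
  haveI : IsLocalHom (algebraMap A B) := hs.isLocalHom
  have hk : RingHom.ker (algebraMap A B) = Ideal.span {x} := Ideal.mk_ker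
  haveI : CharP B p := (CharP.charP_iff_prime_eq_zero (Fact.out (p := p.Prime))).2 (by
    rw [← map_natCast (algebraMap A B), ← RingHom.mem_ker, hk]
    exact hpx)
  obtain ⟨s, hs1, hs2⟩ := Ideal.exists_finset_card_eq_height_of_isNoetherianRing (IsLocalRing.maximalIdeal B)
  have hdim : ringKrullDim B = (s.card : WithBot ℕ∞) := by
    rw [← IsLocalRing.maximalIdeal_height_eq_ringKrullDim, ← hs2]; rfl
  have hAB := ringKrullDim_le_ringKrullDim_quotient_add_card (R := A) {x} (by
    rw [IsLocalRing.ringJacobson_eq_maximalIdeal]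
    simpa using hxm)
  rw [Finset.coe_singleton, Finset.card_singleton] at hAB
  have hAB : ringKrullDim A ≤ ringKrullDim B + (1 : ℕ) := hAB
  rw [hdim] at hAB
  have hnd : n ≤ s.card := by
    have := (not_le.1 hcon).trans_le hAB
    have : n < s.card + 1 := by exact_mod_cast this
    omega
  choose g hg using hs
  have hgm : ∀ b ∈ IsLocalRing.maximalIdeal B, g b ∈ IsLocalRing.maximalIdeal A := by
    intro b hb
    rw [← hg b] at hb
    exact fun hu => hb (hu.map _)
  have hsm : ∀ b ∈ s, b ∈ IsLocalRing.maximalIdeal B := fun b hb => hs1.1.2 (Ideal.subset_span hb)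
  refine core (B := B) p hx0 (fun b => ⟨g b, hg b⟩) hk F n hn
    (fun y hy => NHT_pow F n hn y (hF y hy)) hne s.card hnd hdim.ge (s.toList.map g) (by simp) ?_ ?_
  · intro a ha
    obtain ⟨b, hb, rfl⟩ := List.mem_map.1 ha
    exact hgm b (hsm b (Finset.mem_toList.1 hb))
  · intro I hI h1 h2
    have hkI : RingHom.ker (algebraMap A B) ≤ I := by
      rw [hk, Ideal.span_singleton_le_iff_mem]; exact h2
    have hsurj : Function.Surjective (algebraMap A B) := fun b => ⟨g b, hg b⟩
    haveI hP : (I.map (algebraMap A B)).IsPrime := Ideal.map_isPrime_of_surjective hsurj hkI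
    have h3 : IsLocalRing.maximalIdeal B ≤ I.map (algebraMap A B) := by
      refine hs1.2 ⟨hP, ?_⟩ (IsLocalRing.le_maximalIdeal hP.ne_top)
      rw [Ideal.span_le]
      intro b hb
      have := Ideal.mem_map_of_mem (algebraMap A B) (h1 (g b) (List.mem_map.2 ⟨b, Finset.mem_toList.2 hb, rfl⟩))
      rwa [hg] at this
    intro y hy
    have h4 := h3 (map_nonunit (algebraMap A B) y hy)
    have h5 : y ∈ (I.map (algebraMap A B)).comap (algebraMap A B) := h4
    rw [Ideal.comap_map_of_surjective _ hsurj] at h5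
    exact (sup_le le_rfl hkI : _ ≤ I) h5
end
end FM

end

section
open CategoryTheory

lemma kill_fl {A : Type} [CommRing A] [IsLocalRing A] {H : Type*} [AddCommGroup H] [Module A H]
    (h : IsFiniteLength A H) (y : A) (hy : y ∈ IsLocalRing.maximalIdeal A) :
    ∃ N : ℕ, ∀ z : H, y ^ N • z = 0 := by
  obtain ⟨h1, h2⟩ := isFiniteLength_iff_isNoetherian_isArtinian.1 h
  let f : ℕ →o (Submodule A H)ᵒᵈ := ⟨fun N => OrderDual.toDual (LinearMap.range (LinearMap.lsmul A H (y ^ N))), by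
    refine monotone_nat_of_le_succ fun N => ?_
    rintro _ ⟨z, rfl⟩
    exact ⟨y • z, by simp only [LinearMap.lsmul_apply, pow_succ, mul_smul]⟩⟩
  obtain ⟨N, hN⟩ := IsArtinian.monotone_stabilizes f
  have e : LinearMap.range (LinearMap.lsmul A H (y ^ N)) = LinearMap.range (LinearMap.lsmul A H (y ^ (N+1))) :=
    hN (N+1) (by omega)
  have hb := Submodule.eq_bot_of_le_smul_of_le_jacobson_bot (IsLocalRing.maximalIdeal A)
    (LinearMap.range (LinearMap.lsmul A H (y ^ N))) (IsNoetherian.noetherian _) (by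
      conv_lhs => rw [e]
      rintro _ ⟨z, rfl⟩
      have : (LinearMap.lsmul A H (y ^ (N+1))) z = y • (LinearMap.lsmul A H (y ^ N)) z := by
        simp [pow_succ', mul_smul]
      rw [this]
      exact Submodule.smul_mem_smul hy ⟨z, rfl⟩) (IsLocalRing.maximalIdeal_le_jacobson _)
  refine ⟨N, fun z => ?_⟩
  have : (LinearMap.lsmul A H (y ^ N)) z ∈ LinearMap.range (LinearMap.lsmul A H (y ^ N)) := ⟨z, rfl⟩
  rw [hb] at this
  exact this

namespace FM
section
variable {A : Type} [CommRing A]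

/-- matrix form of a complex with bases -/
noncomputable def ofBasis (F : ChainComplex (ModuleCat A) ℕ) (r : ℕ → ℕ)
    (b : ∀ i, Module.Basis (Fin (r i)) A (F.X i)) : ChainComplex (FM A) ℕ where
  X i := FM.mk (Fin (r i))
  d i j := hom (X := FM.mk (Fin (r i))) (Y := FM.mk (Fin (r j))) (LinearMap.toMatrix (b i) (b j) (F.d i j).hom)
  shape i j h := by
    rw [F.shape i j h]
    exact map_zero (LinearMap.toMatrix (b i) (b j))
  d_comp_d' i j k _ _ := by
    have := LinearMap.toMatrix_comp (b i) (b j) (b k) (F.d j k).hom (F.d i j).hom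
    refine this.symm.trans ?_
    rw [← ModuleCat.hom_comp, F.d_comp_d]
    exact map_zero (LinearMap.toMatrix (b i) (b k))

lemma Zk_ofBasis (F : ChainComplex (ModuleCat A) ℕ) (r : ℕ → ℕ)
    (b : ∀ i, Module.Basis (Fin (r i)) A (F.X i)) (a : A) (k : ℕ) :
    Zk (ofBasis F r b) a k ↔ ∀ z, (F.d k (k-1)).hom z = 0 → ∃ w, (F.d (k+1) k).hom w = a • z := by
  have e : ∀ i j (z : F.X i), (LinearMap.toMatrix (b i) (b j) (F.d i j).hom).mulVec ((b i).equivFun z) = (b j).equivFun ((F.d i j).hom z) :=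
    fun i j z => LinearMap.toMatrix_mulVec_repr (b i) (b j) (F.d i j).hom z
  constructor
  · intro h z hz
    obtain ⟨(w : Fin (r (k+1)) → A), hw⟩ := h ((b k).equivFun z) ((e k (k-1) z).trans (by rw [hz, map_zero]; rfl))
    refine ⟨(b (k+1)).equivFun.symm w, ?_⟩
    apply (b k).equivFun.injective
    rw [← e, LinearEquiv.apply_symm_apply, map_smul]
    exact hw
  · intro h (v : Fin (r k) → A) hv
    obtain ⟨w, hw⟩ := h ((b k).equivFun.symm v) (by
      apply (b (k-1)).equivFun.injective
      rw [← e, LinearEquiv.apply_symm_apply, map_zero]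
      exact hv)
    refine ⟨(b (k+1)).equivFun w, (e (k+1) k w).trans ?_⟩
    rw [hw, map_smul, LinearEquiv.apply_symm_apply]
    rfl
end
end FM

end

/-- The New Intersection Theorem for complete Noetherian local domains with algebraically
closed residue field of positive characteristic:  if `F : 0 → F_n → ⋯ → F_0 → 0` is a
complex of finite rank free `A`-modules with nonzero homology of finite length, then
`n ≥ dim A`.  (This is deduced in the paper from the strict positivity of the Dutta
multiplicity of `F ⊗_A A/(x)` when `n < dim A`, combined with its vanishing.) -/
theorem stmt_18 (A : Type) [CommRing A] [IsNoetherianRing A] [IsLocalRing A] [IsDomain A]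
    [IsAdicComplete (IsLocalRing.maximalIdeal A) A]
    (p : ℕ) [Fact p.Prime] [CharP (IsLocalRing.ResidueField A) p]
    [IsAlgClosed (IsLocalRing.ResidueField A)]
    (F : ChainComplex (ModuleCat A) ℕ) (n : ℕ)
    (hbdd : ∀ i : ℕ, n < i → Subsingleton (F.X i))
    (hfree : ∀ i : ℕ, Module.Free A (F.X i) ∧ Module.Finite A (F.X i))
    (hfl : ∀ i : ℕ, IsFiniteLength A (F.homology i))
    (hne : ∃ i : ℕ, Nontrivial (F.homology i)) :
    ringKrullDim A ≤ (n : WithBot (WithTop ℕ)) := by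
  haveI := fun i => (hfree i).1
  haveI := fun i => (hfree i).2
  refine FM.NIT_FM p (FM.ofBasis F (fun i => Module.finrank A (F.X i))
    (fun i => Module.finBasis A (F.X i))) n ?_ ?_ ?_
  · intro i hi
    haveI := hbdd i hi
    have h0 : Module.finrank A (F.X i) = 0 := Module.finrank_zero_of_subsingleton
    change IsEmpty (Fin (Module.finrank A (F.X i)))
    rw [h0]
    infer_instance
  · intro y hy k
    obtain ⟨N, hN⟩ := kill_fl (hfl k) y hy
    obtain ⟨π, hπ, hb⟩ := hom_concrete F k
    refine ⟨N, (FM.Zk_ofBasis _ _ _ _ _).2 fun z hz => ?_⟩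
    have h1 : π (y ^ N • ⟨z, hz⟩) = 0 := by rw [map_smul]; exact hN _
    exact (hb _).1 h1
  · obtain ⟨i, hi⟩ := hne
    refine ⟨i, fun h => ?_⟩
    have h := (FM.Zk_ofBasis _ _ _ _ _).1 h
    obtain ⟨π, hπ, hb⟩ := hom_concrete F i
    obtain ⟨u, hu⟩ := exists_ne (0 : F.homology i)
    obtain ⟨z, rfl⟩ := hπ u
    refine hu ((hb z).2 ?_)
    obtain ⟨w, hw⟩ := h z.1 z.2
    exact ⟨w, by rw [hw, one_smul]⟩
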